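/- Let M ∈ ℤ≥0, n_i ∈ ℚ, A_i ∈ yℌ, B_i ∈ ℌx (1 ≤ i ≤ M) satisfy ∑_{i=1}^M n_i f(A_i, B_i) = 0 in ℝ^ℕ. Then the element ∑_{i=1}^M n_i A_i B_i of ℌ lies in the ℚ-linear span of {φ(u ∗ v)x : u, v ∈ yℌ}; in particular, the relation ∑_{i=1}^M n_i Z(A_i B_i) = 0 is a consequence of the linear part of Kawashima's relation. -/

import Mathlib

open scoped BigOperators

noncomputable section

/-- `ℌ = ℚ⟨x,y⟩`, the free noncommutative polynomial ring in two indeterminates,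
realized as the free `ℚ`-algebra on `Bool` (`false ↦ x`, `true ↦ y`). -/
abbrev H : Type := FreeAlgebra ℚ Bool

/-- The indeterminate `x`. -/
def Hx : H := FreeAlgebra.ι ℚ false

/-- The indeterminate `y`. -/
def Hy : H := FreeAlgebra.ι ℚ true

/-- The multiple zeta value `ζ(k₁,…,k_r) = ∑_{0<n₁<⋯<n_r} 1/(n₁^{k₁}⋯n_r^{k_r})`. -/
def MZV (r : ℕ) (k : Fin r → ℕ) : ℝ :=
  ∑' n : {n : Fin r → ℕ // (∀ i, 0 < n i) ∧ StrictMono n},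
    ∏ i, (1 : ℝ) / (n.1 i : ℝ) ^ (k i)

/-- `Z : yℌx → ℝ` is the `ℚ`-linear map with `Z(y x^{k₁-1} ⋯ y x^{k_r-1}) = ζ(k₁,…,k_r)`.
We encode it as a `ℚ`-linear map on all of `ℌ` whose values on the basis monomials
`y x^{k₁-1} ⋯ y x^{k_r-1}` (with `k_r ≥ 2`) of `yℌx` are the multiple zeta values;
these values determine `Z` uniquely on the subspace `yℌx`. -/
def IsZetaMap (Z : H →ₗ[ℚ] ℝ) : Prop :=
  ∀ (r : ℕ) (k : Fin (r + 1) → ℕ), (∀ i, 1 ≤ k i) → 2 ≤ k (Fin.last r) →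
    Z ((List.ofFn fun i => Hy * Hx ^ (k i - 1)).prod) = MZV (r + 1) k

/-- The family `f(A,B) = (Z(A(x+y)^s B))_{s ≥ 0}`. -/
def fam (Z : H →ₗ[ℚ] ℝ) (A B : H) : ℕ → ℝ := fun s => Z (A * (Hx + Hy) ^ s * B)

/-- The `ℚ`-bilinear product `◇` on `ℌ`, characterized by its recursive defining
properties (which determine it uniquely). -/
def IsDiamond (d : H →ₗ[ℚ] H →ₗ[ℚ] H) : Prop :=
  (∀ w, d w 1 = w) ∧ (∀ w, d 1 w = w) ∧
  (∀ w1 w2, d (Hx * w1) (Hx * w2) = Hx * d w1 (Hx * w2) - Hx * d (Hy * w1) w2) ∧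
  (∀ w1 w2, d (Hx * w1) (Hy * w2) = Hx * d w1 (Hy * w2) + Hy * d (Hx * w1) w2) ∧
  (∀ w1 w2, d (Hy * w1) (Hx * w2) = Hy * d w1 (Hx * w2) + Hx * d (Hy * w1) w2) ∧
  (∀ w1 w2, d (Hy * w1) (Hy * w2) = Hy * d w1 (Hy * w2) - Hy * d (Hx * w1) w2)

/-- The harmonic product `∗` on `ℌ`, characterized by its recursive defining
properties (which determine it uniquely). -/
def IsHarmonic (st : H →ₗ[ℚ] H →ₗ[ℚ] H) : Prop :=
  (∀ w, st w 1 = w) ∧ (∀ w, st 1 w = w) ∧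
  (∀ w1 w2, st (Hx * w1) w2 = Hx * st w1 w2) ∧
  (∀ w1 w2, st w1 (Hx * w2) = Hx * st w1 w2) ∧
  (∀ w1 w2, st (Hy * w1) (Hy * w2) = Hy * (st w1 (Hy * w2) + st (Hy * w1) w2 + Hx * st w1 w2))

/-- The anti-automorphism `τ` of `ℌ` interchanging `x` and `y`, characterized by
being `ℚ`-linear, anti-multiplicative, unital, and swapping the generators. -/
def IsTau (t : H →ₗ[ℚ] H) : Prop :=
  t 1 = 1 ∧ (∀ a b, t (a * b) = t b * t a) ∧ t Hx = Hy ∧ t Hy = Hx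

/-- The automorphism `φ` of `ℌ` with `φ(x) = x + y` and `φ(y) = -y`. -/
def phi : H →ₐ[ℚ] H := FreeAlgebra.lift ℚ (fun b => if b then -Hy else Hx + Hy)

/-- The automorphism `S₁` of `ℌ` with `S₁(x) = x` and `S₁(y) = x + y`. -/
def S1 : H →ₐ[ℚ] H := FreeAlgebra.lift ℚ (fun b => if b then Hx + Hy else Hx)

/-- The Dirichlet series `∑_{n ≥ 1} a_n / n^s` (with `a n` the coefficient indexed by
`n + 1`) converges to `L` at `s`, i.e. its partial sums tend to `L`. -/
def DSConv (a : ℕ → ℝ) (s : ℕ) (L : ℝ) : Prop :=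
  Filter.Tendsto (fun N => ∑ n ∈ Finset.range N, a n / ((n : ℝ) + 1) ^ s)
    Filter.atTop (nhds L)



/-! ### Part 1 : algebra -/

/-- the word as an element of `H` -/
def wd (L : List Bool) : H := (L.map (FreeAlgebra.ι ℚ)).prod

lemma wd_nil : wd [] = 1 := rfl

lemma wd_cons (b : Bool) (L : List Bool) : wd (b :: L) = FreeAlgebra.ι ℚ b * wd L := by
  simp [wd]

lemma wd_append (L L' : List Bool) : wd (L ++ L') = wd L * wd L' := by
  simp [wd]

lemma wd_single (b : Bool) : wd [b] = FreeAlgebra.ι ℚ b := by simp [wd]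

lemma wd_true : wd [true] = Hy := wd_single true
lemma wd_false : wd [false] = Hx := wd_single false

lemma span_wd : Submodule.span ℚ (Set.range wd) = ⊤ := by
  rw [eq_top_iff]
  rintro a -
  induction a using FreeAlgebra.induction with
  | grade0 r =>
    rw [Algebra.algebraMap_eq_smul_one]
    exact Submodule.smul_mem _ _ (Submodule.subset_span ⟨[], rfl⟩)
  | grade1 b => exact Submodule.subset_span ⟨[b], wd_single b⟩
  | mul a b ha hb =>
    have := Submodule.mul_mem_mul ha hb
    rw [Submodule.span_mul_span] at this
    refine Submodule.span_mono ?_ this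
    rintro _ ⟨_, ⟨L, rfl⟩, _, ⟨L', rfl⟩, rfl⟩
    exact ⟨L ++ L', wd_append L L'⟩
  | add a b ha hb => exact Submodule.add_mem _ ha hb

lemma H_ind {p : H → Prop} (h1 : ∀ L, p (wd L)) (h2 : ∀ a b, p a → p b → p (a + b))
    (h3 : ∀ (c : ℚ) a, p a → p (c • a)) (a : H) : p a := by
  have ha : a ∈ Submodule.span ℚ (Set.range wd) := by rw [span_wd]; trivial
  induction ha using Submodule.span_induction with
  | mem x hx => obtain ⟨L, rfl⟩ := hx; exact h1 L
  | zero => simpa using h3 0 _ (h1 [])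
  | add x y _ _ hx hy => exact h2 _ _ hx hy
  | smul c x _ hx => exact h3 _ _ hx

/-- division by the index -/
def opX : Module.End ℚ (ℕ → ℚ) where
  toFun f n := f n / n
  map_add' f g := by ext n; simp [add_div]
  map_smul' c f := by ext n; simp [mul_div_assoc]

/-- strict partial sums divided by the index -/
def opY : Module.End ℚ (ℕ → ℚ) where
  toFun f n := (∑ m ∈ Finset.range n, f m) / n
  map_add' f g := by ext n; simp [add_div, Finset.sum_add_distrib]
  map_smul' c f := by
    ext n
    simp only [Pi.smul_apply, smul_eq_mul, RingHom.id_apply, Finset.mul_sum, Finset.sum_div, mul_div_assoc]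

/-- right action -/
def Lam : H →ₐ[ℚ] (Module.End ℚ (ℕ → ℚ))ᵐᵒᵖ :=
  FreeAlgebra.lift ℚ (fun b => MulOpposite.op (if b then opY else opX))

/-- truncated sums with prescribed last index -/
def hh : H →ₗ[ℚ] (ℕ → ℚ) where
  toFun u := (Lam u).unop (Pi.single 0 1)
  map_add' u v := by simp
  map_smul' c u := by simp

lemma hh_mul_ι (u : H) (b : Bool) :
    hh (u * FreeAlgebra.ι ℚ b) = (if b then opY else opX) (hh u) := by
  cases b <;> simp [hh, Lam]

lemma hh_x (u : H) (n : ℕ) : hh (u * Hx) n = hh u n / n := by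
  rw [Hx, hh_mul_ι]; rfl

lemma hh_y (u : H) (n : ℕ) : hh (u * Hy) n = (∑ m ∈ Finset.range n, hh u m) / n := by
  rw [Hy, hh_mul_ι]; rfl

lemma hh_one (n : ℕ) : hh 1 n = if n = 0 then 1 else 0 := by
  simp [hh, Pi.single_apply]

lemma hh_zero_append (L : List Bool) (b : Bool) : hh (wd (L ++ [b])) 0 = 0 := by
  rw [wd_append, wd_single]
  cases b
  · exact (hh_x _ _).trans (by simp)
  · exact (hh_y _ _).trans (by simp)

lemma hh_zero_y (p : H) : hh (Hy * p) 0 = 0 := by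
  induction p using H_ind with
  | h1 L =>
    rw [← wd_true, ← wd_append]
    rcases List.eq_nil_or_concat ([true] ++ L) with h | ⟨L', b, h⟩
    · simp at h
    · rw [h]; simpa using hh_zero_append L' b
  | h2 a b ha hb => rw [mul_add, map_add, Pi.add_apply, ha, hb, add_zero]
  | h3 c a ha => rw [mul_smul_comm, map_smul, Pi.smul_apply, ha, smul_zero]

/-- left action, truncated at `N` -/
def lopX : Module.End ℚ (ℕ → ℚ) := opX

/-- left action of `y`, truncated at `N` -/
def lopY (N : ℕ) : Module.End ℚ (ℕ → ℚ) where
  toFun f m := ∑ n ∈ Finset.Ioo m N, f n / n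
  map_add' f g := by ext n; simp [add_div, Finset.sum_add_distrib]
  map_smul' c f := by
    ext n
    simp only [Pi.smul_apply, smul_eq_mul, RingHom.id_apply, Finset.mul_sum, Finset.sum_div, mul_div_assoc]

/-- left action -/
def rho (N : ℕ) : H →ₐ[ℚ] Module.End ℚ (ℕ → ℚ) :=
  FreeAlgebra.lift ℚ (fun b => if b then lopY N else lopX)

lemma rho_x (N : ℕ) (f : ℕ → ℚ) (m : ℕ) : rho N Hx f m = f m / m := by
  simp [rho, Hx]; rfl

lemma rho_y (N : ℕ) (f : ℕ → ℚ) (m : ℕ) : rho N Hy f m = ∑ n ∈ Finset.Ioo m N, f n / n := by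
  simp [rho, Hy]; rfl

lemma adj (N : ℕ) (w : H) : ∀ f g : ℕ → ℚ,
    ∑ n ∈ Finset.range N, (Lam w).unop f n * g n = ∑ n ∈ Finset.range N, f n * rho N w g n := by
  induction w using FreeAlgebra.induction with
  | grade0 r => intro f g; simp [Algebra.algebraMap_eq_smul_one]; congr! 1; ring
  | grade1 b =>
    intro f g
    cases b
    · simp only [Lam, rho, FreeAlgebra.lift_ι_apply]
      simp [opX, lopX]; congr! 1; ring
    · simp only [Lam, rho, FreeAlgebra.lift_ι_apply]
      simp only [if_true, MulOpposite.unop_op, opY, lopY, LinearMap.coe_mk, AddHom.coe_mk]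
      simp only [Finset.sum_div, Finset.sum_mul, Finset.mul_sum]
      rw [Finset.sum_sigma', Finset.sum_sigma']
      refine Finset.sum_bij' (fun a _ => ⟨a.2, a.1⟩) (fun a _ => ⟨a.2, a.1⟩) ?_ ?_ ?_ ?_ ?_
      · rintro ⟨a, b⟩ h; simp at h ⊢; omega
      · rintro ⟨a, b⟩ h; simp at h ⊢; omega
      · rintro ⟨a, b⟩ h; rfl
      · rintro ⟨a, b⟩ h; rfl
      · rintro ⟨a, b⟩ h; simp; ring
  | mul a b ha hb =>
    intro f g
    simp only [map_mul, MulOpposite.unop_mul, Module.End.mul_apply]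
    rw [hb, ha]
  | add a b ha hb =>
    intro f g
    simp only [map_add, MulOpposite.unop_add, LinearMap.add_apply, Pi.add_apply, add_mul, mul_add,
      Finset.sum_add_distrib]
    rw [hb, ha]

lemma sum_hh (N : ℕ) (w : H) :
    ∑ n ∈ Finset.range (N + 1), hh w n = rho (N + 1) w (fun _ => 1) 0 := by
  have := adj (N + 1) w (Pi.single 0 1) (fun _ => 1)
  simp only [mul_one] at this
  refine this.trans ?_
  rw [Finset.sum_eq_single 0] <;> simp +contextual

lemma yy_aux (N : ℕ) (a b : ℕ → ℚ) (d : ℕ) : ∀ m, N ≤ m + d →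
    ∑ n ∈ Finset.Ioo m N, (a n * (∑ k ∈ Finset.Ioo n N, b k / k) +
      (∑ k ∈ Finset.Ioo n N, a k / k) * b n + a n * b n / n) / n
    = (∑ k ∈ Finset.Ioo m N, a k / k) * (∑ k ∈ Finset.Ioo m N, b k / k) := by
  induction d with
  | zero => intro m hm; rw [Finset.Ioo_eq_empty (by omega)]; simp
  | succ d ih =>
    intro m hm
    by_cases h : m + 1 < N
    · have h2 : Finset.Ioo m N = insert (m + 1) (Finset.Ioo (m + 1) N) := by
        ext k; simp; omega
      rw [h2, Finset.sum_insert (by simp), Finset.sum_insert (by simp),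
        Finset.sum_insert (by simp), ih (m + 1) (by omega)]
      have : ((m + 1 : ℕ) : ℚ) ≠ 0 := by positivity
      field_simp
      ring
    · have h2 : Finset.Ioo m N = ∅ := by ext k; simp; omega
      rw [h2]; simp

lemma rho_st (st : H →ₗ[ℚ] H →ₗ[ℚ] H) (hst : IsHarmonic st) (N : ℕ) (u v : H) :
    rho N (st u v) (fun _ => 1) = rho N u (fun _ => 1) * rho N v (fun _ => 1) := by
  obtain ⟨h1, h2, h3, h4, h5⟩ := hst
  have key : ∀ k : ℕ, ∀ L L' : List Bool, L.length + L'.length ≤ k →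
      rho N (st (wd L) (wd L')) (fun _ => 1) =
        rho N (wd L) (fun _ => 1) * rho N (wd L') (fun _ => 1) := by
    intro k
    induction k with
    | zero =>
      intro L L' h
      have e1 : L = [] := by apply List.length_eq_zero_iff.1; omega
      have e2 : L' = [] := by apply List.length_eq_zero_iff.1; omega
      subst e1 e2
      rw [wd_nil, h1]; ext; simp
    | succ k ih =>
      intro L L' h
      match L, L', h with
      | [], L', _ => rw [wd_nil, h2]; ext; simp
      | L, [], _ => rw [wd_nil, h1]; ext; simp
      | false :: L, L', h =>
        rw [wd_cons]
        change rho N (st (Hx * wd L) _) _ = rho N (Hx * wd L) _ * _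
        simp only [List.length_cons] at h
        rw [h3, map_mul, Module.End.mul_apply, ih L L' (by omega)]
        ext m
        simp only [Pi.mul_apply, map_mul, Module.End.mul_apply, rho_x]
        ring
      | L, false :: L', h =>
        rw [wd_cons]
        change rho N (st _ (Hx * wd L')) _ = _ * rho N (Hx * wd L') _
        simp only [List.length_cons] at h
        rw [h4, map_mul, Module.End.mul_apply, ih L L' (by omega)]
        ext m
        simp only [Pi.mul_apply, map_mul, Module.End.mul_apply, rho_x]
        ring
      | true :: L, true :: L', h =>
        simp only [List.length_cons] at h
        have i1 := ih L (true :: L') (by simp only [List.length_cons]; omega)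
        have i2 := ih (true :: L) L' (by simp only [List.length_cons]; omega)
        have i3 := ih L L' (by omega)
        rw [wd_cons] at i1 i2
        rw [wd_cons, wd_cons]
        change rho N (st _ (Hy * wd L')) _ = _ * rho N (Hy * wd L') _ at i1
        change rho N (st (Hy * wd L) _) _ = rho N (Hy * wd L) _ * _ at i2
        change rho N (st (Hy * wd L) (Hy * wd L')) _ = rho N (Hy * wd L) _ * rho N (Hy * wd L') _
        rw [h5, map_mul, Module.End.mul_apply]
        rw [map_add (rho N), map_add (rho N), LinearMap.add_apply, LinearMap.add_apply, i1, i2]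
        ext m
        simp only [Pi.mul_apply, map_mul, Module.End.mul_apply, rho_y]
        refine Eq.trans ?_ (yy_aux N (rho N (wd L) fun _ => 1) (rho N (wd L') fun _ => 1) N m
          (by omega))
        refine Finset.sum_congr rfl ?_
        intro n _
        simp only [Pi.add_apply, rho_x, i3, Pi.mul_apply, rho_y]
  induction u using H_ind with
  | h1 L =>
    induction v using H_ind with
    | h1 L' => exact key _ L L' le_rfl
    | h2 a b ha hb => simp [ha, hb, mul_add]
    | h3 c a ha => simp [ha]
  | h2 a b ha hb => simp [ha, hb, add_mul]
  | h3 c a ha => simp [ha]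

lemma sum_st (st : H →ₗ[ℚ] H →ₗ[ℚ] H) (hst : IsHarmonic st) (N : ℕ) (u v : H) :
    ∑ n ∈ Finset.range (N + 1), hh (st u v) n =
      (∑ n ∈ Finset.range (N + 1), hh u n) * ∑ n ∈ Finset.range (N + 1), hh v n := by
  rw [sum_hh, sum_hh, sum_hh, rho_st st hst, Pi.mul_apply]

/-- the anti-automorphism `x ↦ x`, `y ↦ -(x+y)` -/
def sig : H →ₐ[ℚ] Hᵐᵒᵖ :=
  FreeAlgebra.lift ℚ (fun b => MulOpposite.op (if b then -(Hx + Hy) else Hx))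

/-- the span of products -/
def II (st : H →ₗ[ℚ] H →ₗ[ℚ] H) : Submodule ℚ H :=
  Submodule.span ℚ {w : H | ∃ p q : H, w = st (Hy * p) (Hy * q)}

lemma exists_w (st : H →ₗ[ℚ] H →ₗ[ℚ] H) (hst : IsHarmonic st) (v : H) : ∀ p : H, ∃ q : H,
    (∀ n : ℕ, hh (Hy * q) n = n * hh (Hy * p) n * hh (Hy * v) n) ∧
    Hy * p * (sig v).unop - Hy * q ∈ II st := by
  induction v using H_ind with
  | h1 L =>
    induction L using List.reverseRecOn with
    | nil =>
      intro p
      refine ⟨p, fun n => ?_, by simp [wd_nil]⟩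
      rcases Nat.eq_zero_or_pos n with rfl | hn
      · simp [hh_zero_y]
      · have h1 : hh (Hy * wd []) n = 1 / n := by
          have := hh_y 1 n
          rw [wd_nil, mul_one]
          rw [one_mul] at this
          rw [this]
          simp only [hh_one]
          rw [Finset.sum_eq_single 0] <;> simp +contextual; omega
        rw [h1]; field_simp
    | append_singleton L b ih =>
      intro p
      cases b
      · obtain ⟨q, hq1, hq2⟩ := ih (p * Hx)
        refine ⟨q, fun n => ?_, ?_⟩
        · rw [hq1, wd_append, wd_false, ← mul_assoc, ← mul_assoc, hh_x, hh_x]; ring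
        · convert hq2 using 2
          rw [wd_append, map_mul, MulOpposite.unop_mul, wd_false]
          simp [sig, Hx, mul_assoc]
      · obtain ⟨q, hq1, hq2⟩ := ih (p * Hx)
        obtain ⟨r, hr1, hr2⟩ := ih (p * Hy)
        obtain ⟨h1, h2, h3, h4, h5⟩ := hst
        have e := h5 p (wd L)
        set t := st p (Hy * wd L) + st (Hy * p) (wd L) + Hx * st p (wd L) with ht
        refine ⟨t - q - r, fun n => ?_, ?_⟩
        · rcases Nat.eq_zero_or_pos n with rfl | hn
          · simp [hh_zero_y]
          obtain ⟨N, rfl⟩ : ∃ N, n = N + 1 := ⟨n - 1, by omega⟩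
          have s1 := sum_st st ⟨h1, h2, h3, h4, h5⟩ N (Hy * p) (Hy * wd L)
          have s2 := sum_st st ⟨h1, h2, h3, h4, h5⟩ (N + 1) (Hy * p) (Hy * wd L)
          rw [Finset.sum_range_succ, Finset.sum_range_succ _ (N + 1),
            Finset.sum_range_succ _ (N + 1), s1, e] at s2
          rw [mul_sub, mul_sub, map_sub, map_sub, Pi.sub_apply, Pi.sub_apply, hq1, hr1, wd_append,
            wd_true, ← mul_assoc, ← mul_assoc, ← mul_assoc, hh_x, hh_y, hh_y]
          have : ((N + 1 : ℕ) : ℚ) ≠ 0 := by positivity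
          field_simp
          linear_combination s2
        · have : Hy * p * (sig (wd (L ++ [true]))).unop - Hy * (t - q - r)
            = -(Hy * (p * Hx) * (sig (wd L)).unop - Hy * q)
              - (Hy * (p * Hy) * (sig (wd L)).unop - Hy * r) - st (Hy * p) (Hy * wd L) := by
            rw [e, wd_append, map_mul, MulOpposite.unop_mul, wd_true]
            have : (sig Hy).unop = -(Hx + Hy) := by simp [sig, Hy]
            rw [this]; noncomm_ring
          rw [this]
          exact Submodule.sub_mem _ (Submodule.sub_mem _ (Submodule.neg_mem _ hq2) hr2)
            (Submodule.subset_span ⟨_, _, rfl⟩)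
  | h2 a b ha hb =>
    intro p
    obtain ⟨q, hq1, hq2⟩ := ha p
    obtain ⟨r, hr1, hr2⟩ := hb p
    refine ⟨q + r, fun n => ?_, ?_⟩
    · rw [mul_add, mul_add, map_add, map_add, Pi.add_apply, Pi.add_apply, hq1, hr1]; ring
    · have := Submodule.add_mem _ hq2 hr2
      convert this using 1
      rw [map_add, MulOpposite.unop_add]; noncomm_ring
  | h3 c a ha =>
    intro p
    obtain ⟨q, hq1, hq2⟩ := ha p
    refine ⟨c • q, fun n => ?_, ?_⟩
    · rw [mul_smul_comm, mul_smul_comm, map_smul, map_smul, Pi.smul_apply, Pi.smul_apply, hq1]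
      simp only [smul_eq_mul]; ring
    · have := Submodule.smul_mem _ c hq2
      convert this using 1
      rw [map_smul, MulOpposite.unop_smul, mul_smul_comm, mul_smul_comm, smul_sub]

/-! ### Part 2 : injectivity of `hh` on `yH` -/

open Polynomial in
/-- `z(1-z) d/dz` on polynomials -/
def thP (p : ℚ[X]) : ℚ[X] := X * (1 - X) * derivative p

/-- `z(1-z) d/dz` on power series -/
def thS (f : PowerSeries ℚ) : PowerSeries ℚ :=
  PowerSeries.X * (1 - PowerSeries.X) * PowerSeries.derivative ℚ f

open Polynomial in
lemma thP_add (p q : ℚ[X]) : thP (p + q) = thP p + thP q := by simp [thP, mul_add]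

open Polynomial in
lemma thS_mul (p : ℚ[X]) (f : PowerSeries ℚ) :
    thS ((p : PowerSeries ℚ) * f) = (thP p : ℚ[X]) * f + p * thS f := by
  simp only [thS, thP, Derivation.leibniz, smul_eq_mul, Polynomial.coe_mul, Polynomial.coe_sub,
    Polynomial.coe_X, Polynomial.coe_one, PowerSeries.derivative_coe]
  ring

lemma thS_add (f g : PowerSeries ℚ) : thS (f + g) = thS f + thS g := by simp [thS, mul_add]

/-- polylogarithms as power series; lists are read backwards -/
def Li (l : List Bool) : PowerSeries ℚ := PowerSeries.mk (hh (wd l.reverse))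

/-- the word read backwards is empty or starts with `y` -/
def good : List Bool → Prop
  | [] => True
  | [b] => b = true
  | _ :: c :: l => good (c :: l)

lemma Li_nil : Li [] = 1 := by
  ext n
  simp [Li, wd_nil, hh_one, PowerSeries.coeff_one]

lemma good_tail {b : Bool} {l : List Bool} (h : good (b :: l)) : good l := by
  cases l with
  | nil => trivial
  | cons c l => exact h

lemma one_sub_mul_coeff (f : PowerSeries ℚ) (n : ℕ) :
    PowerSeries.coeff (n + 1) ((1 - PowerSeries.X) * f) =
      PowerSeries.coeff (n + 1) f - PowerSeries.coeff n f := by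
  rw [sub_mul, one_mul, map_sub, PowerSeries.coeff_succ_X_mul]

lemma one_sub_mul_coeff_zero (f : PowerSeries ℚ) :
    PowerSeries.coeff 0 ((1 - PowerSeries.X) * f) = PowerSeries.coeff 0 f := by
  rw [sub_mul, one_mul, map_sub, PowerSeries.coeff_zero_X_mul, sub_zero]

lemma thS_Li_true (l : List Bool) : thS (Li (true :: l)) = PowerSeries.X * Li l := by
  rw [thS, mul_assoc]
  congr 1
  ext n
  have e : ∀ n : ℕ, PowerSeries.coeff n (PowerSeries.derivative ℚ (Li (true :: l))) =
      ∑ m ∈ Finset.range (n + 1), hh (wd l.reverse) m := by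
    intro n
    rw [PowerSeries.coeff_derivative, Li, PowerSeries.coeff_mk, List.reverse_cons, wd_append,
      wd_true, hh_y]
    push_cast
    have : (n : ℚ) + 1 ≠ 0 := by positivity
    field_simp
  cases n with
  | zero => rw [one_sub_mul_coeff_zero, e]; simp [Li]
  | succ n => rw [one_sub_mul_coeff, e, e, Finset.sum_range_succ]; simp [Li]

lemma thS_Li_false (l : List Bool) (h : good (false :: l)) :
    thS (Li (false :: l)) = (1 - PowerSeries.X) * Li l := by
  rw [thS, mul_comm PowerSeries.X, mul_assoc]
  congr 1
  ext n
  cases n with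
  | zero =>
    rw [PowerSeries.coeff_zero_X_mul]
    cases l with
    | nil => simp [good] at h
    | cons c l =>
      rw [Li, PowerSeries.coeff_mk, List.reverse_cons, hh_zero_append]
  | succ n =>
    rw [PowerSeries.coeff_succ_X_mul, PowerSeries.coeff_derivative, Li, Li, PowerSeries.coeff_mk,
      PowerSeries.coeff_mk, List.reverse_cons, wd_append, wd_false, hh_x]
    push_cast
    have : (n : ℚ) + 1 ≠ 0 := by positivity
    field_simp

open Polynomial in
/-- combination of polylogarithms -/
def Ph : (List Bool →₀ ℚ[X]) →+ PowerSeries ℚ :=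
  Finsupp.liftAddHom (fun l => (AddMonoidHom.mulRight (Li l)).comp
    (Polynomial.coeToPowerSeries.ringHom (R := ℚ)).toAddMonoidHom)

open Polynomial in
lemma Ph_single (l : List Bool) (q : ℚ[X]) : Ph (Finsupp.single l q) = q * Li l := by
  simp [Ph]

open Polynomial in
lemma Ph_smul (q : ℚ[X]) (p : List Bool →₀ ℚ[X]) : Ph (q • p) = q * Ph p := by
  induction p using Finsupp.induction_linear with
  | zero => simp
  | add f g hf hg => rw [smul_add, map_add, map_add, hf, hg, mul_add]
  | single l r => rw [Finsupp.smul_single, Ph_single, Ph_single, smul_eq_mul, Polynomial.coe_mul, mul_assoc]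

open Polynomial in
/-- the derivation on coefficients, one word -/
def der1 : List Bool → ℚ[X] → (List Bool →₀ ℚ[X])
  | [], q => Finsupp.single [] (thP q)
  | false :: l, q => Finsupp.single (false :: l) (thP q) + Finsupp.single l ((1 - X) * q)
  | true :: l, q => Finsupp.single (true :: l) (thP q) + Finsupp.single l (X * q)

open Polynomial in
lemma der1_add (l : List Bool) (p q : ℚ[X]) : der1 l (p + q) = der1 l p + der1 l q := by
  match l with
  | [] => simp [der1, thP_add]
  | false :: l => simp only [der1, thP_add, mul_add, Finsupp.single_add]; abel
  | true :: l => simp only [der1, thP_add, mul_add, Finsupp.single_add]; abel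

open Polynomial in
/-- the derivation on coefficients -/
def der : (List Bool →₀ ℚ[X]) →+ (List Bool →₀ ℚ[X]) :=
  Finsupp.liftAddHom (fun l => AddMonoidHom.mk' (der1 l) (der1_add l))

open Polynomial in
lemma der_single (l : List Bool) (q : ℚ[X]) : der (Finsupp.single l q) = der1 l q := by
  rw [der, Finsupp.liftAddHom_apply_single]; rfl

open Polynomial in
lemma der_apply (p : List Bool →₀ ℚ[X]) (v : List Bool) :
    der p v = thP (p v) + (1 - X) * p (false :: v) + X * p (true :: v) := by
  induction p using Finsupp.induction_linear with
  | zero => simp [thP]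
  | add f g hf hg =>
    rw [map_add, Finsupp.add_apply, hf, hg]; simp only [Finsupp.add_apply, thP_add]; ring
  | single l r =>
    rw [der_single]
    have h0 : thP 0 = 0 := by simp [thP]
    match l with
    | [] =>
      by_cases h : v = []
      · subst h; simp [der1]
      · simp [der1, Finsupp.single_apply, Ne.symm h, h0]
    | false :: l =>
      simp only [der1, Finsupp.add_apply, Finsupp.single_apply]
      by_cases h : false :: l = v
      · have : l ≠ v := by rintro rfl; simp at h
        subst h; simp
      · by_cases h' : l = v
        · subst h'; simp [h, h0]
        · simp [h, h', h0]
    | true :: l =>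
      simp only [der1, Finsupp.add_apply, Finsupp.single_apply]
      by_cases h : true :: l = v
      · have : l ≠ v := by rintro rfl; simp at h
        subst h; simp
      · by_cases h' : l = v
        · subst h'; simp [h, h0]
        · simp [h, h', h0]

open Polynomial in
lemma thS_Ph (p : List Bool →₀ ℚ[X]) (hp : ∀ l, p l ≠ 0 → good l) : thS (Ph p) = Ph (der p) := by
  induction p using Finsupp.induction with
  | zero => simp [thS]
  | single_add l b f hl hb ih =>
    have hg : good l := by
      apply hp
      rw [Finsupp.add_apply, Finsupp.single_eq_same, Finsupp.notMem_support_iff.1 hl, add_zero]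
      exact hb
    rw [map_add, map_add, map_add, thS_add, ih]
    · congr 1
      rw [der_single, Ph_single, thS_mul]
      match l, hg with
      | [], _ => simp [der1, Ph_single, Li_nil, thS]
      | false :: l, hg =>
        simp only [der1, map_add, Ph_single, thS_Li_false l hg]
        simp only [Polynomial.coe_mul, Polynomial.coe_sub, Polynomial.coe_X, Polynomial.coe_one]
        ring
      | true :: l, hg =>
        simp only [der1, map_add, Ph_single, thS_Li_true l]
        simp only [Polynomial.coe_mul, Polynomial.coe_X]
        ring
    · intro l' hl'
      apply hp
      rw [Finsupp.add_apply, Finsupp.single_apply]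
      split_ifs with h
      · subst h; exact absurd (Finsupp.notMem_support_iff.1 hl) hl'
      · simpa using hl'

open Polynomial in
lemma coeff_thP_succ (p : ℚ[X]) (n : ℕ) :
    (thP p).coeff (n + 1) = (n + 1) * p.coeff (n + 1) - n * p.coeff n := by
  have : thP p = X * derivative p - X * (X * derivative p) := by rw [thP]; ring
  rw [this, coeff_sub, coeff_X_mul, coeff_X_mul, coeff_derivative]
  cases n with
  | zero => simp
  | succ n => rw [coeff_X_mul, coeff_derivative]; push_cast; ring

open Polynomial in
lemma coeff_thP_zero (p : ℚ[X]) : (thP p).coeff 0 = 0 := by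
  rw [thP, mul_assoc, coeff_X_mul_zero]

open Polynomial in
lemma const_of_thP (p0 p : ℚ[X]) (h0 : p0 ≠ 0) (h : p0 * thP p = thP p0 * p) :
    ∃ c : ℚ, p = C c * p0 := by
  have h' : ∀ q : ℚ[X], p0 * thP q = thP p0 * q → p0 * derivative q = derivative p0 * q := by
    intro q hq
    have hne : (X * (1 - X) : ℚ[X]) ≠ 0 := by
      apply mul_ne_zero X_ne_zero
      intro h
      have := congrArg (Polynomial.eval 0) h
      simp at this
    apply mul_left_cancel₀ hne
    rw [thP, thP] at hq
    linear_combination hq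
  have deg : ∀ q : ℚ[X], q ≠ 0 → p0 * derivative q = derivative p0 * q →
      q.natDegree = p0.natDegree := by
    intro q hq0 hq
    have key : X * (p0 * derivative q) = X * (derivative p0 * q) := by rw [hq]
    have e1 : X * (p0 * derivative q) = p0 * (X * derivative q) := by ring
    have e2 : X * (derivative p0 * q) = (X * derivative p0) * q := by ring
    rw [e1, e2] at key
    have hd : ∀ r : ℚ[X], (X * derivative r).natDegree ≤ r.natDegree ∧
        (X * derivative r).coeff r.natDegree = r.natDegree * r.leadingCoeff := by
      intro r
      have hc : ∀ n, (X * derivative r).coeff n = n * r.coeff n := by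
        intro n
        cases n with
        | zero => simp
        | succ n => rw [coeff_X_mul, coeff_derivative]; push_cast; ring
      constructor
      · rw [natDegree_le_iff_coeff_eq_zero]
        intro n hn
        rw [hc, coeff_eq_zero_of_natDegree_lt hn, mul_zero]
      · rw [hc]; rfl
    have k2 := congrArg (fun r => r.coeff (p0.natDegree + q.natDegree)) key
    beta_reduce at k2
    rw [coeff_mul_add_eq_of_natDegree_le le_rfl (hd q).1,
      coeff_mul_add_eq_of_natDegree_le (hd p0).1 le_rfl, (hd q).2, (hd p0).2] at k2
    have l1 : p0.leadingCoeff ≠ 0 := leadingCoeff_ne_zero.2 h0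
    have l2 : q.leadingCoeff ≠ 0 := leadingCoeff_ne_zero.2 hq0
    have : (q.natDegree : ℚ) = p0.natDegree := by
      apply mul_right_cancel₀ (mul_ne_zero l1 l2)
      simp only [Polynomial.leadingCoeff] at *
      linear_combination k2
    exact_mod_cast this
  by_cases hp : p = 0
  · exact ⟨0, by simp [hp]⟩
  have hp1 := h' p h
  have d1 := deg p hp hp1
  refine ⟨p.leadingCoeff / p0.leadingCoeff, ?_⟩
  by_contra hne
  set c := p.leadingCoeff / p0.leadingCoeff with hc
  have l1 : p0.leadingCoeff ≠ 0 := leadingCoeff_ne_zero.2 h0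
  have hcne : c ≠ 0 := div_ne_zero (leadingCoeff_ne_zero.2 hp) l1
  have d2 := deg (p - C c * p0) (sub_ne_zero.2 hne) (by
    rw [derivative_sub, derivative_C_mul]; linear_combination hp1)
  have d3 : (p - C c * p0).degree < p.degree := by
    apply degree_sub_lt_left
    · rw [degree_eq_natDegree hp, degree_C_mul hcne, degree_eq_natDegree h0, d1]
    · exact hp
    · rw [leadingCoeff_mul, leadingCoeff_C, hc]; field_simp
  have := natDegree_lt_natDegree (sub_ne_zero.2 hne) d3
  omega

open Polynomial in
lemma no_prim0 (p0 p : ℚ[X]) (h0 : p0 ≠ 0) (c0 c1 : ℚ)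
    (h : p0 * thP p - thP p0 * p + p0 * p0 * ((1 - X) * C c0 + X * C c1) = 0) :
    c0 = 0 := by
  have tr : ∀ f g : ℚ[X], ∀ a b : ℕ, (∀ i < a, f.coeff i = 0) → (∀ i < b, g.coeff i = 0) →
      (∀ i < a + b, (f * g).coeff i = 0) ∧ (f * g).coeff (a + b) = f.coeff a * g.coeff b := by
    intro f g a b hf hg
    constructor
    · intro i hi
      rw [coeff_mul]
      apply Finset.sum_eq_zero
      rintro ⟨j, k⟩ hjk
      replace hjk : j + k = _ := Finset.HasAntidiagonal.mem_antidiagonal.1 hjk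
      by_cases hj : j < a
      · simp [hf j hj]
      · simp [hg k (by omega)]
    · rw [coeff_mul, Finset.sum_eq_single (a, b)]
      · rintro ⟨j, k⟩ hjk hne
        replace hjk : j + k = _ := Finset.HasAntidiagonal.mem_antidiagonal.1 hjk
        by_cases hj : j < a
        · simp [hf j hj]
        · have : k < b := by
            by_contra hk
            apply hne
            simp only [Prod.mk.injEq]; omega
          simp [hg k this]
      · simp
  have thl : ∀ f : ℚ[X], ∀ a : ℕ, (∀ i < a, f.coeff i = 0) →
      (∀ i < a, (thP f).coeff i = 0) ∧ (thP f).coeff a = a * f.coeff a := by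
    intro f a hf
    constructor
    · intro i hi
      cases i with
      | zero => exact coeff_thP_zero f
      | succ n => rw [coeff_thP_succ, hf _ hi, hf n (by omega)]; ring
    · cases a with
      | zero => rw [coeff_thP_zero]; simp
      | succ n => rw [coeff_thP_succ, hf n (by omega)]; push_cast; ring
  set m := p0.natTrailingDegree with hm
  have hm0 : p0.coeff m ≠ 0 := by
    rw [hm]; exact trailingCoeff_nonzero_iff_nonzero.2 h0
  have hml : ∀ i < m, p0.coeff i = 0 := fun i hi => coeff_eq_zero_of_lt_natTrailingDegree hi
  have q2 := tr _ _ m m hml hml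
  have q3 := tr (p0 * p0) ((1 - X) * C c0 + X * C c1) (m + m) 0 q2.1 (by simp)
  have q3c : ((1 - X) * C c0 + X * C c1 : ℚ[X]).coeff 0 = c0 := by
    simp [sub_mul, coeff_X_mul_zero]
  by_contra hc
  · skip
    have hpm : ∀ a, (∀ i < a, p.coeff i = 0) → a ≤ m → ∀ i < a + 1, p.coeff i = 0 ∨ a = m := by
      intro a ha ham i hi
      by_cases hlt : i < a
      · exact Or.inl (ha i hlt)
      have : i = a := by omega
      subst this
      by_cases hiam : i = m
      · exact Or.inr hiam
      left
      have u1 := (tr p0 (thP p) m i hml (thl p i ha).1).2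
      have u2 := (tr (thP p0) p m i (thl p0 m hml).1 ha).2
      have u3 := q3.1 (m + i) (by omega)
      have := congrArg (fun r => r.coeff (m + i)) h
      simp only [coeff_add, coeff_sub, coeff_zero] at this
      rw [u1, u2, (thl p i ha).2, (thl p0 m hml).2] at this
      have u3' : (p0 * p0 * ((1 - X) * C c0 + X * C c1)).coeff (m + i) = 0 := q3.1 (m + i) (by omega)
      rw [u3'] at this
      have h2 : ((i : ℚ) - m) * p0.coeff m * p.coeff i = 0 := by linear_combination this
      have h3 : ((i : ℚ) - m) ≠ 0 := by
        rw [sub_ne_zero]; exact_mod_cast hiam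
      simpa [h3, hm0] using h2
    have hpl : ∀ a ≤ m, ∀ i < a, p.coeff i = 0 := by
      intro a
      induction a with
      | zero => intro _ i hi; omega
      | succ a ih =>
        intro ham i hi
        rcases hpm a (ih (by omega)) (by omega) i hi with h | h
        · exact h
        · omega
    have ha := hpl m le_rfl
    have u1 := (tr p0 (thP p) m m hml (thl p m ha).1).2
    have u2 := (tr (thP p0) p m m (thl p0 m hml).1 ha).2
    have u3 := q3.2
    rw [add_zero, q2.2, q3c] at u3
    have := congrArg (fun r => r.coeff (m + m)) h
    simp only [coeff_add, coeff_sub, coeff_zero] at this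
    rw [u1, u2, (thl p m ha).2, (thl p0 m hml).2] at this
    rw [u3] at this
    have h2 : p0.coeff m * p0.coeff m * c0 = 0 := by linear_combination this
    simp [hm0, hc] at h2

open Polynomial in
lemma thP_comp (p : ℚ[X]) : thP (p.comp (1 - X)) = -((thP p).comp (1 - X)) := by
  simp only [thP, derivative_comp, mul_comp, sub_comp, one_comp, X_comp, derivative_sub,
    derivative_one, derivative_X]
  ring

open Polynomial in
lemma no_prim (p0 p : ℚ[X]) (h0 : p0 ≠ 0) (c0 c1 : ℚ)
    (h : p0 * thP p - thP p0 * p + p0 * p0 * ((1 - X) * C c0 + X * C c1) = 0) :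
    c0 = 0 ∧ c1 = 0 := by
  refine ⟨no_prim0 p0 p h0 c0 c1 h, ?_⟩
  have hcomp : ∀ q : ℚ[X], (q.comp (1 - X)).comp (1 - X) = q := by
    intro q
    rw [comp_assoc]; simp
  apply no_prim0 (p0.comp (1 - X)) (-(p.comp (1 - X))) _ c1 c0
  · have h2 := congrArg (fun r => r.comp (1 - X)) h
    simp only [add_comp, sub_comp, mul_comp, one_comp, X_comp, C_comp, zero_comp] at h2
    have h3 : thP (-(p.comp (1 - X))) = (thP p).comp (1 - X) := by
      rw [← neg_inj, ← thP_comp]; simp [thP]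
    rw [h3, thP_comp]
    linear_combination h2
  · intro hz
    apply h0
    rw [← hcomp p0, hz, zero_comp]

open Polynomial in
lemma indep (d : ℕ) : ∀ (c : ℕ) (p : List Bool →₀ ℚ[X]), (∀ l, p l ≠ 0 → good l ∧ l.length ≤ d) →
    (p.support.filter (fun l => l.length = d)).card ≤ c → Ph p = 0 → p = 0 := by
  induction d with
  | zero =>
    intro c p hp _ hPh
    have e : p = Finsupp.single [] (p []) := by
      ext1 l
      by_cases h : l = []
      · subst h; simp
      · rw [Finsupp.single_apply, if_neg (Ne.symm h)]
        by_contra hne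
        have := (hp l hne).2
        simp at this
        exact h this
    rw [e, Ph_single, Li_nil, mul_one] at hPh
    have : p [] = 0 := by exact_mod_cast hPh
    rw [e, this]; simp
  | succ d ihd =>
    intro c
    induction c with
    | zero =>
      intro p hp hc hPh
      apply ihd _ p _ le_rfl hPh
      intro l hl
      refine ⟨(hp l hl).1, ?_⟩
      have h1 := (hp l hl).2
      by_contra hlt
      have : l ∈ p.support.filter (fun l => l.length = d + 1) := by
        rw [Finset.mem_filter, Finsupp.mem_support_iff]
        exact ⟨hl, by omega⟩
      have := Finset.card_pos.2 ⟨l, this⟩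
      omega
    | succ c ihc =>
      intro p hp hc hPh
      by_cases hw : ∃ w0, p w0 ≠ 0 ∧ w0.length = d + 1
      · exfalso
        obtain ⟨w0, hw0, hwl⟩ := hw
        have zz : ∀ w : List Bool, d + 1 < w.length → p w = 0 := by
          intro w hw
          by_contra hne
          have := (hp w hne).2
          omega
        set p' : List Bool →₀ ℚ[X] := p w0 • der p - thP (p w0) • p with hp'
        have hap : ∀ v, p' v = p w0 * (thP (p v) + (1 - X) * p (false :: v) + X * p (true :: v))
            - thP (p w0) * p v := by
          intro v
          rw [hp', Finsupp.sub_apply, Finsupp.smul_apply, Finsupp.smul_apply, der_apply,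
            smul_eq_mul, smul_eq_mul]
        have htop : ∀ v : List Bool, v.length = d + 1 → p' v = p w0 * thP (p v) - thP (p w0) * p v := by
          intro v hv
          rw [hap, zz (false :: v) (by simp; omega), zz (true :: v) (by simp; omega)]; ring
        have h0 : p' = 0 := by
          apply ihc
          · intro l hl
            by_contra hcon
            apply hl
            have e1 : p l = 0 := by
              by_contra hne
              exact hcon (hp l hne)
            have e2 : ∀ b, p (b :: l) = 0 := by
              intro b
              by_contra hne
              apply hcon
              have := hp _ hne
              refine ⟨good_tail this.1, ?_⟩
              have := this.2
              simp at this
              omega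
            rw [hap, e1, e2, e2]; simp [thP]
          · have hss : p'.support.filter (fun l => l.length = d + 1) ⊆
                (p.support.filter (fun l => l.length = d + 1)).erase w0 := by
              intro l hl
              rw [Finset.mem_filter, Finsupp.mem_support_iff] at hl
              rw [Finset.mem_erase, Finset.mem_filter, Finsupp.mem_support_iff]
              have := hl.1
              rw [htop l hl.2] at this
              refine ⟨?_, ?_, hl.2⟩
              · rintro rfl
                apply this; ring
              · intro hz
                apply this
                rw [hz]; simp [thP]
            have h1 := Finset.card_le_card hss
            have hmem : w0 ∈ p.support.filter (fun l => l.length = d + 1) := by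
              rw [Finset.mem_filter, Finsupp.mem_support_iff]
              exact ⟨hw0, hwl⟩
            rw [Finset.card_erase_of_mem hmem] at h1
            omega
          · rw [hp', map_sub, Ph_smul, Ph_smul, ← thS_Ph p (fun l hl => (hp l hl).1), hPh]
            simp [thS]
        have hconst : ∀ w : List Bool, w.length = d + 1 → ∃ c : ℚ, p w = C c * p w0 := by
          intro w hw
          apply const_of_thP _ _ hw0
          have := htop w hw
          rw [h0] at this
          simp only [Finsupp.coe_zero, Pi.zero_apply] at this
          linear_combination -this
        match w0, hwl with
        | b :: v, hwl =>
          have hv : v.length = d := by simpa using hwl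
          obtain ⟨c0, hc0⟩ := hconst (false :: v) (by simpa using hv)
          obtain ⟨c1, hc1⟩ := hconst (true :: v) (by simpa using hv)
          have h2 := hap v
          rw [h0] at h2
          simp only [Finsupp.coe_zero, Pi.zero_apply] at h2
          have := no_prim (p (b :: v)) (p v) hw0 c0 c1 (by
            rw [hc0, hc1] at h2
            linear_combination -h2)
          cases b with
          | false => exact hw0 (by rw [hc0, this.1]; simp)
          | true => exact hw0 (by rw [hc1, this.2]; simp)
      · push Not at hw
        apply ihc p hp _ hPh
        rw [Finset.filter_eq_empty_iff.2]
        · simp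
        · intro l hl
          exact hw l (Finsupp.mem_support_iff.1 hl)

open Polynomial in
lemma good_append (l : List Bool) : good (l ++ [true]) := by
  induction l with
  | nil => rfl
  | cons b l ih =>
    cases l with
    | nil => exact ih
    | cons c l => exact ih

open Polynomial in
lemma hh_inj (q : H) (h : ∀ n, hh (Hy * q) n = 0) : Hy * q = 0 := by
  have key : ∀ q : H, ∃ f : List Bool →₀ ℚ, (∀ l, f l ≠ 0 → good l) ∧
      Hy * q = f.sum (fun l c => c • wd l.reverse) := by
    intro q
    induction q using H_ind with
    | h1 L =>
      refine ⟨Finsupp.single (L.reverse ++ [true]) 1, ?_, ?_⟩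
      · intro l hl
        rw [Finsupp.single_apply_ne_zero] at hl
        rw [hl.1]; exact good_append _
      · rw [Finsupp.sum_single_index (by simp)]
        simp [wd_cons, Hy]
    | h2 a b ha hb =>
      obtain ⟨f, hf, ea⟩ := ha
      obtain ⟨g, hg, eb⟩ := hb
      refine ⟨f + g, ?_, ?_⟩
      · intro l hl
        by_cases h1 : f l = 0
        · apply hg
          intro h2; apply hl; rw [Finsupp.add_apply, h1, h2, add_zero]
        · exact hf l h1
      · rw [mul_add, ea, eb, Finsupp.sum_add_index' (by simp) (by intros; rw [add_smul])]
    | h3 c a ha =>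
      obtain ⟨f, hf, ea⟩ := ha
      refine ⟨c • f, ?_, ?_⟩
      · intro l hl
        apply hf
        intro h2; apply hl; rw [Finsupp.smul_apply, h2, smul_zero]
      · rw [mul_smul_comm, ea, Finsupp.sum_smul_index (by simp), Finsupp.smul_sum]
        simp only [smul_smul]
  obtain ⟨f, hf, e⟩ := key q
  have hP : ∀ f : List Bool →₀ ℚ, Ph (f.mapRange (fun c : ℚ => (C c : ℚ[X])) (by simp)) =
      PowerSeries.mk (hh (f.sum (fun l c => c • wd l.reverse))) := by
    intro f
    induction f using Finsupp.induction_linear with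
    | zero => ext n; simp
    | add f g hf hg =>
      rw [Finsupp.mapRange_add (by simp), map_add, hf, hg,
        Finsupp.sum_add_index' (by simp) (by intros; rw [add_smul])]
      ext n; simp
    | single l r =>
      rw [Finsupp.mapRange_single, Ph_single, Finsupp.sum_single_index (by simp), Li]
      ext n; simp
  have h0 : Ph (f.mapRange (fun c : ℚ => (C c : ℚ[X])) (by simp)) = 0 := by
    rw [hP, ← e]
    ext n; simp [h]
  have h1 := indep (f.support.sup List.length) _ _ (by
    intro l hl
    have hl' : f l ≠ 0 := by
      intro h; apply hl; rw [Finsupp.mapRange_apply, h]; simp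
    exact ⟨hf l hl', Finset.le_sup (f := List.length) (Finsupp.mem_support_iff.2 hl')⟩) le_rfl h0
  have h2 : f = 0 := by
    ext l
    have := congrArg (fun g => g l) h1
    simpa using this
  rw [e, h2]; simp

/-! ### Part 4 : the algebraic conclusion -/

/-- the anti-automorphism exchanging `x` and `y` -/
def tau : H →ₐ[ℚ] Hᵐᵒᵖ :=
  FreeAlgebra.lift ℚ (fun b => MulOpposite.op (FreeAlgebra.ι ℚ (!b)))

lemma tau_ι (b : Bool) : (tau (FreeAlgebra.ι ℚ b)).unop = FreeAlgebra.ι ℚ (!b) := by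
  simp [tau]

lemma tau_x : (tau Hx).unop = Hy := tau_ι false
lemma tau_y : (tau Hy).unop = Hx := tau_ι true

lemma phi_x : phi Hx = Hx + Hy := by simp [phi, Hx, Hy]
lemma phi_y : phi Hy = -Hy := by simp [phi, Hx, Hy]

lemma tau_wd (L : List Bool) : (tau (wd L)).unop = wd (L.reverse.map (! ·)) := by
  induction L with
  | nil => simp [wd_nil]
  | cons b L ih =>
    rw [wd_cons, map_mul, MulOpposite.unop_mul, ih, tau_ι]
    rw [List.reverse_cons, List.map_append, wd_append]
    simp [wd_single]

lemma phi_phi (w : H) : phi (phi w) = w := by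
  have : phi.comp phi = AlgHom.id ℚ H := by
    apply FreeAlgebra.hom_ext
    funext b
    cases b
    · change phi (phi Hx) = Hx
      rw [phi_x, map_add, phi_x, phi_y]; simp
    · change phi (phi Hy) = Hy
      rw [phi_y, map_neg, phi_y]; simp
  exact congrArg (fun f => f w) this

lemma tau_tau (w : H) : (tau (tau w).unop).unop = w := by
  induction w using H_ind with
  | h1 L => rw [tau_wd, tau_wd]; congr 1; simp [Function.comp_def]
  | h2 a b ha hb => simp [ha, hb]
  | h3 c a ha => simp [ha]

lemma sig_x : (sig Hx).unop = Hx := by simp [sig, Hx]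
lemma sig_y : (sig Hy).unop = -(Hx + Hy) := by simp [sig, Hy, Hx]

lemma phi_sig (w : H) : phi (sig w).unop = (tau (phi w)).unop := by
  have h : ((AlgHom.op phi).comp sig) = tau.comp phi := by
    apply FreeAlgebra.hom_ext
    funext b
    apply MulOpposite.unop_injective
    cases b
    · change phi (sig Hx).unop = (tau (phi Hx)).unop
      rw [sig_x, phi_x, map_add, MulOpposite.unop_add, tau_x, tau_y, add_comm]
    · change phi (sig Hy).unop = (tau (phi Hy)).unop
      rw [sig_y, phi_y, map_neg, map_neg, map_add, MulOpposite.unop_neg, tau_y, phi_x, phi_y]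
      simp
  have := congrArg (fun f => (f w).unop) h
  simpa using this

lemma final_alg (st : H →ₗ[ℚ] H →ₗ[ℚ] H) (hst : IsHarmonic st)
    (M : ℕ) (c : Fin M → ℚ) (A B : Fin M → H)
    (hA : ∀ i, ∃ w, A i = Hy * w) (hB : ∀ i, ∃ w, B i = w * Hx)
    (h : ∀ k : ℕ, ∑ i, c i * (hh (phi (A i)) k * hh (phi (tau (B i)).unop) k) = 0) :
    (∑ i, c i • (A i * B i)) ∈
      Submodule.span ℚ {w : H | ∃ p q : H, w = phi (st (Hy * p) (Hy * q)) * Hx} := by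
  choose a ha using hA
  choose b hb using hB
  have hu : ∀ i, phi (A i) = Hy * (-(phi (a i))) := by
    intro i; rw [ha, map_mul, phi_y]; simp
  have hv : ∀ i, phi (tau (B i)).unop = Hy * (-(phi (tau (b i)).unop)) := by
    intro i; rw [hb, map_mul, MulOpposite.unop_mul, tau_x, map_mul, phi_y]; simp
  choose q hq1 hq2 using fun i => exists_w st hst (-(phi (tau (b i)).unop)) (-(phi (a i)))
  have hAB : ∀ i, A i * B i =
      -(phi (Hy * (-(phi (a i))) * (sig (-(phi (tau (b i)).unop))).unop) * Hx) := by
    intro i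
    rw [map_mul, ← hu, phi_phi, phi_sig, map_neg, phi_phi, map_neg, MulOpposite.unop_neg, tau_tau,
      hb]
    noncomm_ring
  have hsum : Hy * (∑ i, c i • q i) = 0 := by
    apply hh_inj
    intro n
    have e : Hy * (∑ i, c i • q i) = ∑ i, c i • (Hy * q i) := by
      rw [Finset.mul_sum]; simp
    rw [e, map_sum, Finset.sum_apply]
    simp only [map_smul, Pi.smul_apply, hq1, smul_eq_mul]
    have := h n
    simp only [hu, hv] at this
    have e2 : ∑ i, c i * ((n : ℚ) * hh (Hy * -(phi (a i))) n * hh (Hy * -(phi (tau (b i)).unop)) n)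
       = n * ∑ i, c i * (hh (Hy * -(phi (a i))) n * hh (Hy * -(phi (tau (b i)).unop)) n) := by
      rw [Finset.mul_sum]; apply Finset.sum_congr rfl; intros; ring
    rw [e2, this, mul_zero]
  have hmem : (∑ i, c i • (Hy * (-(phi (a i))) * (sig (-(phi (tau (b i)).unop))).unop)) ∈ II st := by
    have : (∑ i, c i • (Hy * (-(phi (a i))) * (sig (-(phi (tau (b i)).unop))).unop)) =
      ∑ i, c i • (Hy * (-(phi (a i))) * (sig (-(phi (tau (b i)).unop))).unop - Hy * q i) := by
      simp only [smul_sub, Finset.sum_sub_distrib]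
      have e : Hy * (∑ i, c i • q i) = ∑ i, c i • (Hy * q i) := by
        rw [Finset.mul_sum]; simp
      rw [← e, hsum, sub_zero]
    rw [this]
    exact Submodule.sum_mem _ (fun i _ => Submodule.smul_mem _ _ (hq2 i))
  have hfin : ∑ i, c i • (A i * B i) =
      -(phi (∑ i, c i • (Hy * (-(phi (a i))) * (sig (-(phi (tau (b i)).unop))).unop)) * Hx) := by
    rw [map_sum, Finset.sum_mul, ← Finset.sum_neg_distrib]
    apply Finset.sum_congr rfl
    intro i _
    rw [hAB, map_smul, smul_mul_assoc, smul_neg]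
  rw [hfin]
  apply Submodule.neg_mem
  generalize (∑ i, c i • (Hy * (-(phi (a i))) * (sig (-(phi (tau (b i)).unop))).unop)) = W at hmem
  rw [II] at hmem
  induction hmem using Submodule.span_induction with
  | mem w hw =>
    obtain ⟨p, q, rfl⟩ := hw
    exact Submodule.subset_span ⟨p, q, rfl⟩
  | zero => simp
  | add x y _ _ hx hy => rw [map_add, add_mul]; exact Submodule.add_mem _ hx hy
  | smul a x _ hx => rw [map_smul, smul_mul_assoc]; exact Submodule.smul_mem _ _ hx

/-! ### Part three a : iterated integrals and series -/

/-- the two weights `1/(1+e^m)` and `e^m/(1+e^m)` -/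
def om (b : Bool) (m : ℝ) : ℝ := if b then Real.exp m / (1 + Real.exp m) else 1 / (1 + Real.exp m)

/-- the weights in `ENNReal` -/
def omE (b : Bool) (m : ℝ) : ENNReal := ENNReal.ofReal (om b m)

lemma om_pos (b : Bool) (m : ℝ) : 0 < om b m := by
  unfold om; split_ifs <;> positivity

lemma om_add (m : ℝ) : om false m + om true m = 1 := by
  simp only [om]; have := Real.exp_pos m
  simp; field_simp

lemma om_neg (b : Bool) (m : ℝ) : om b (-m) = om (!b) m := by
  have := Real.exp_pos m
  cases b
  · simp only [om, Real.exp_neg, Bool.not_false, if_true, Bool.false_eq_true, if_false]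
    field_simp; try ring
  · simp only [om, Real.exp_neg, Bool.not_true, if_true, Bool.false_eq_true, if_false]
    field_simp; try ring

lemma om_le_one (b : Bool) (m : ℝ) : om b m ≤ 1 := by
  have h1 := om_pos false m
  have h2 := om_pos true m
  have := om_add m
  cases b <;> linarith

lemma om_true_le (m : ℝ) : om true m ≤ Real.exp m := by
  have := Real.exp_pos m
  simp only [om, if_true]
  apply div_le_self this.le; linarith

lemma om_cont (b : Bool) : Continuous (om b) := by
  have : ∀ m : ℝ, 1 + Real.exp m ≠ 0 := fun m => by positivity
  cases b
  · change Continuous (fun m => 1 / (1 + Real.exp m))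
    exact Continuous.div (by fun_prop) (by fun_prop) this
  · change Continuous (fun m => Real.exp m / (1 + Real.exp m))
    exact Continuous.div (by fun_prop) (by fun_prop) this

lemma omE_meas (b : Bool) : Measurable (omE b) := (om_cont b).measurable.ennreal_ofReal

lemma omE_add (m : ℝ) : omE false m + omE true m = 1 := by
  rw [omE, omE, ← ENNReal.ofReal_add (om_pos _ _).le (om_pos _ _).le, om_add]; simp

lemma omE_ne_top (b : Bool) (m : ℝ) : omE b m ≠ ⊤ := ENNReal.ofReal_ne_top

lemma omE_ne_zero (b : Bool) (m : ℝ) : omE b m ≠ 0 := by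
  rw [omE]; simpa using om_pos b m

lemma omE_sub (m : ℝ) : 1 - omE true m = omE false m := by
  rw [← omE_add m, ENNReal.add_sub_cancel_right (omE_ne_top _ _)]

lemma omp_meas (d : Bool) (n : ℕ) : Measurable (fun m => omE true m ^ n * omE d m) :=
  ((omE_meas true).pow_const n).mul (omE_meas d)

lemma om_deriv (n : ℕ) (m : ℝ) :
    HasDerivAt (fun x => om true x ^ (n + 1) / (n + 1)) (om true m ^ (n + 1) * om false m) m := by
  have h1 : HasDerivAt (om true) (om true m * om false m) m := by
    have e : om true = fun x => Real.exp x / (1 + Real.exp x) := by funext x; simp [om]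
    have hp : 1 + Real.exp m ≠ 0 := by positivity
    rw [e]
    refine ((Real.hasDerivAt_exp m).div ((Real.hasDerivAt_exp m).const_add 1) hp).congr_deriv ?_
    simp only [om, Bool.false_eq_true, if_false]; field_simp; ring
  refine ((h1.pow (n + 1)).div_const ((n : ℝ) + 1)).congr_deriv ?_
  have : (n : ℝ) + 1 ≠ 0 := by positivity
  push_cast; field_simp; ring

lemma om_true_tendsto_bot : Filter.Tendsto (om true) Filter.atBot (nhds 0) := by
  apply squeeze_zero (fun m => (om_pos true m).le) om_true_le
  exact Real.tendsto_exp_atBot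

lemma om_true_tendsto_top : Filter.Tendsto (om true) Filter.atTop (nhds 1) := by
  have h : Filter.Tendsto (fun m => om true (-m)) Filter.atBot (nhds 1) := by
    have : (fun m => om true (-m)) = fun m => 1 - om true m := by
      funext m; rw [om_neg]; have := om_add m; simp; linarith
    rw [this]
    simpa using om_true_tendsto_bot.const_sub 1
  have := h.comp Filter.tendsto_neg_atTop_atBot
  simpa [Function.comp_def] using this

open MeasureTheory in
lemma om_integrable (n : ℕ) : Integrable (fun m => om true m ^ (n + 1) * om false m) := by
  have hc : Continuous (fun m => om true m ^ (n + 1) * om false m) :=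
    ((om_cont true).pow _).mul (om_cont false)
  have hle : ∀ m, om true m ^ (n + 1) ≤ om true m := fun m =>
    pow_le_of_le_one (om_pos _ _).le (om_le_one _ _) (by omega)
  rw [← integrableOn_univ, ← Set.Iic_union_Ioi (a := (0 : ℝ))]
  apply IntegrableOn.union
  · apply Integrable.mono' (integrableOn_exp_Iic 0) hc.aestronglyMeasurable
    apply Filter.Eventually.of_forall
    intro m
    rw [Real.norm_of_nonneg (by have := om_pos true m; have := om_pos false m; positivity)]
    calc om true m ^ (n + 1) * om false m ≤ om true m * 1 :=
          mul_le_mul (hle m) (om_le_one _ _) (om_pos _ _).le (om_pos _ _).le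
      _ ≤ _ := by rw [mul_one]; exact om_true_le m
  · apply Integrable.mono' (integrableOn_exp_neg_Ioi 0) hc.aestronglyMeasurable
    apply Filter.Eventually.of_forall
    intro m
    rw [Real.norm_of_nonneg (by have := om_pos true m; have := om_pos false m; positivity)]
    calc om true m ^ (n + 1) * om false m ≤ 1 * om false m :=
          mul_le_mul_of_nonneg_right ((hle m).trans (om_le_one _ _)) (om_pos _ _).le
      _ ≤ _ := by
        rw [one_mul]; have := om_neg true m; simp only [Bool.not_true] at this
        rw [← this]; exact om_true_le (-m)

open MeasureTheory in
lemma lint_om (n : ℕ) (x : ℝ) :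
    ∫⁻ m in Set.Iio x, omE true m ^ (n + 1) * omE false m = omE true x ^ (n + 1) / (n + 1 : ℕ) := by
  have e : ∀ m, omE true m ^ (n + 1) * omE false m =
      ENNReal.ofReal (om true m ^ (n + 1) * om false m) := by
    intro m
    rw [ENNReal.ofReal_mul (by have := om_pos true m; positivity), omE, omE,
      ENNReal.ofReal_pow (om_pos _ _).le]
  simp only [e]
  rw [setLIntegral_congr Iio_ae_eq_Iic,
    ← ofReal_integral_eq_lintegral_ofReal (om_integrable n).integrableOn
      (Filter.Eventually.of_forall (fun m => by
        have := om_pos true m; have := om_pos false m; simp only [Pi.zero_apply]; positivity)),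
    integral_Iic_of_hasDerivAt_of_tendsto' (m := 0) (fun m _ => om_deriv n m)
      (om_integrable n).integrableOn, sub_zero, ENNReal.ofReal_div_of_pos (by positivity), omE,
      ENNReal.ofReal_pow (om_pos _ _).le]
  · congr 1
    rw [← ENNReal.ofReal_natCast]; push_cast; rfl
  · have := (om_true_tendsto_bot.pow (n + 1)).div_const ((n : ℝ) + 1)
    simpa using this

open MeasureTheory in
lemma lint_om_univ (n : ℕ) :
    ∫⁻ m, omE true m ^ (n + 1) * omE false m = 1 / (n + 1 : ℕ) := by
  have e : ∀ m, omE true m ^ (n + 1) * omE false m =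
      ENNReal.ofReal (om true m ^ (n + 1) * om false m) := by
    intro m
    rw [ENNReal.ofReal_mul (by have := om_pos true m; positivity), omE, omE,
      ENNReal.ofReal_pow (om_pos _ _).le]
  simp only [e]
  rw [← ofReal_integral_eq_lintegral_ofReal (om_integrable n)
      (Filter.Eventually.of_forall (fun m => by
        have := om_pos true m; have := om_pos false m; simp only [Pi.zero_apply]; positivity)),
    integral_of_hasDerivAt_of_tendsto (m := 0) (n := 1 / ((n : ℝ) + 1)) (fun m => om_deriv n m)
      (om_integrable n), sub_zero, ENNReal.ofReal_div_of_pos (by positivity)]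
  · congr 1
    · simp
    · rw [← ENNReal.ofReal_natCast]; push_cast; rfl
  · have := (om_true_tendsto_bot.pow (n + 1)).div_const ((n : ℝ) + 1)
    simpa using this
  · have := (om_true_tendsto_top.pow (n + 1)).div_const ((n : ℝ) + 1)
    simpa using this

lemma omE_geom (n : ℕ) (m : ℝ) :
    omE true m ^ n * omE true m = ∑' k, if n < k then omE true m ^ k * omE false m else 0 := by
  have hinj : Function.Injective (fun j : ℕ => n + 1 + j) := fun a b h => by simpa using h
  rw [← hinj.tsum_eq]
  · have : ∀ j : ℕ, (if n < n + 1 + j then omE true m ^ (n + 1 + j) * omE false m else 0) =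
        omE true m ^ (n + 1) * omE false m * omE true m ^ j := by
      intro j; rw [if_pos (by omega), pow_add]; ring
    simp only [this]
    rw [ENNReal.tsum_mul_left, ENNReal.tsum_geometric, omE_sub, mul_assoc,
      ENNReal.mul_inv_cancel (omE_ne_zero _ _) (omE_ne_top _ _), mul_one, pow_succ]
  · intro k hk
    by_cases h : n < k
    · exact ⟨k - (n + 1), by simp; omega⟩
    · simp [h] at hk

open MeasureTheory in
/-- iterated integrals; lists are read backwards -/
def FE : List Bool → ℝ → ENNReal
  | [] => fun _ => 1
  | b :: l => fun x => ∫⁻ m in Set.Iio x, FE l m * omE b m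

/-- coefficients; lists are read backwards -/
def aE : List Bool → ℕ → ENNReal
  | [] => fun n => if n = 0 then 1 else 0
  | false :: l => fun n => if n = 0 then 0 else aE l n / n
  | true :: l => fun n => if n = 0 then 0 else (∑ m ∈ Finset.range n, aE l m) / n

lemma aE_zero (b : Bool) (l : List Bool) : aE (b :: l) 0 = 0 := by
  cases b <;> simp [aE]

open MeasureTheory in
lemma FE_mono (l : List Bool) : Monotone (FE l) := by
  cases l with
  | nil => intro x y _; simp [FE]
  | cons b l =>
    intro x y h
    exact lintegral_mono_set (Set.Iio_subset_Iio h)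

lemma FE_meas (l : List Bool) : Measurable (FE l) := (FE_mono l).measurable

open MeasureTheory in
lemma FE_series (l : List Bool) (hl : good l) (x : ℝ) :
    FE l x = ∑' n, aE l n * omE true x ^ n := by
  induction l generalizing x with
  | nil =>
    rw [tsum_eq_single 0]
    · simp [FE, aE]
    · intro n hn; simp [aE, hn]
  | cons b l ih =>
    have hm : ∀ c d n, Measurable (fun m => (c : ENNReal) * (omE true m ^ (n : ℕ) * omE d m)) :=
      fun c d n => (omp_meas d n).const_mul c
    simp only [FE, ih (good_tail hl)]
    cases b with
    | false =>
      cases l with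
      | nil => simp [good] at hl
      | cons c l =>
        simp only [← ENNReal.tsum_mul_right, mul_assoc]
        rw [lintegral_tsum (fun n => (hm _ _ _).aemeasurable)]
        apply tsum_congr
        intro n
        rw [lintegral_const_mul _ (omp_meas _ n)]
        cases n with
        | zero => simp [aE_zero]
        | succ n =>
          rw [lint_om]
          simp only [aE, if_neg (Nat.succ_ne_zero n)]
          simp only [div_eq_mul_inv]; ring
    | true =>
      simp only [← ENNReal.tsum_mul_right, mul_assoc, omE_geom, ← ENNReal.tsum_mul_left]
      have hmm : ∀ n k : ℕ, Measurable (fun m => aE l n *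
          (if n < k then omE true m ^ k * omE false m else 0)) := by
        intro n k
        split_ifs
        · exact hm _ _ _
        · simp
      rw [lintegral_tsum (fun n => (Measurable.tsum (hmm n)).aemeasurable)]
      simp only [lintegral_tsum (fun k => (hmm _ k).aemeasurable)]
      rw [ENNReal.tsum_comm]
      apply tsum_congr
      intro k
      cases k with
      | zero => simp [aE]
      | succ k =>
        have : ∀ n, ∫⁻ m in Set.Iio x, aE l n *
            (if n < k + 1 then omE true m ^ (k + 1) * omE false m else 0) =
            if n < k + 1 then aE l n * (omE true x ^ (k + 1) / (k + 1 : ℕ)) else 0 := by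
          intro n
          split_ifs
          · rw [lintegral_const_mul _ (omp_meas _ _), lint_om]
          · simp
        simp only [this]
        rw [tsum_eq_sum (s := Finset.range (k + 1))]
        · simp only [aE, if_neg (Nat.succ_ne_zero k)]
          rw [Finset.sum_congr rfl (g := fun n => aE l n * (omE true x ^ (k + 1) / (k + 1 : ℕ)))]
          · rw [← Finset.sum_mul]
            simp only [div_eq_mul_inv]; ring
          · intro n hn; rw [if_pos (Finset.mem_range.1 hn)]
        · intro n hn; rw [if_neg (by simpa using hn)]

open MeasureTheory in
lemma FE_total (b : Bool) (l : List Bool) (hl : good (b :: l)) :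
    ∫⁻ m, FE (b :: l) m * omE false m = ∑' n, aE (false :: b :: l) n := by
  simp only [FE_series _ hl, ← ENNReal.tsum_mul_right, mul_assoc]
  rw [lintegral_tsum (fun n =>
    ((omp_meas _ n).const_mul _).aemeasurable)]
  apply tsum_congr
  intro n
  rw [lintegral_const_mul _ (omp_meas _ n)]
  cases n with
  | zero => simp [aE_zero]
  | succ n =>
    rw [lint_om_univ]
    simp only [aE, if_neg (Nat.succ_ne_zero n)]
    simp only [div_eq_mul_inv, one_mul]

/-! ### Part three b : the link with multiple zeta values -/

/-- positive strictly increasing tuples -/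
def PP {r : ℕ} (t : Fin r → ℕ) : Prop := (∀ i, 0 < t i) ∧ StrictMono t

lemma PP_snoc {r : ℕ} (t : Fin (r + 1) → ℕ) (m : ℕ) :
    PP (Fin.snoc t m : Fin (r + 2) → ℕ) ↔ PP t ∧ t (Fin.last r) < m := by
  constructor
  · rintro ⟨h1, h2⟩
    refine ⟨⟨fun i => ?_, fun i j hij => ?_⟩, ?_⟩
    · simpa using h1 i.castSucc
    · simpa using h2 (Fin.castSucc_lt_castSucc_iff.2 hij)
    · simpa using h2 (Fin.castSucc_lt_last (Fin.last r))
  · rintro ⟨⟨h1, h2⟩, h3⟩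
    refine ⟨fun i => ?_, ?_⟩
    · refine Fin.lastCases ?_ (fun j => ?_) i
      · simp; omega
      · simpa using h1 j
    · rw [Fin.strictMono_iff_lt_succ]
      intro i
      refine Fin.lastCases ?_ (fun j => ?_) i
      · simpa using h3
      · rw [Fin.succ_castSucc, Fin.snoc_castSucc, Fin.snoc_castSucc]
        exact h2 (Fin.castSucc_lt_succ)

open Classical in
/-- truncated nested sums with fixed last index -/
def W (r : ℕ) (k : Fin (r + 1) → ℕ) (n : ℕ) : ENNReal :=
  ∑' t : Fin (r + 1) → ℕ, if PP t ∧ t (Fin.last r) = n then ∏ i, ((t i : ENNReal) ^ (k i))⁻¹ else 0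

open Classical in
lemma W_snoc (r : ℕ) (k : Fin (r + 1) → ℕ) (n : ℕ) :
    W (r + 1) (Fin.snoc k 1 : Fin (r + 2) → ℕ) n = (∑ m ∈ Finset.range n, W r k m) / n := by
  unfold W
  rw [← (Fin.snocEquiv (fun _ : Fin (r + 2) => ℕ)).tsum_eq]
  have e : ∀ p : ℕ × (Fin (r + 1) → ℕ),
      (if PP (Fin.snocEquiv (fun _ : Fin (r + 2) => ℕ) p) ∧
        (Fin.snocEquiv (fun _ : Fin (r + 2) => ℕ) p) (Fin.last (r + 1)) = n then
        ∏ i, (((Fin.snocEquiv (fun _ : Fin (r + 2) => ℕ) p) i : ENNReal) ^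
          ((Fin.snoc k 1 : Fin (r + 2) → ℕ) i))⁻¹ else 0) =
      if (PP p.2 ∧ p.2 (Fin.last r) < p.1) ∧ p.1 = n then
        (∏ i, ((p.2 i : ENNReal) ^ (k i))⁻¹) * (p.1 : ENNReal)⁻¹ else 0 := by
    rintro ⟨m, t⟩
    have e1 : Fin.snocEquiv (fun _ : Fin (r + 2) => ℕ) (m, t) = (Fin.snoc t m : Fin (r + 2) → ℕ) := rfl
    rw [e1, PP_snoc, Fin.snoc_last]
    simp only [Fin.prod_univ_castSucc (n := r + 1), Fin.snoc_castSucc, Fin.snoc_last, pow_one]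
  rw [tsum_congr e, ENNReal.tsum_prod (f := fun m t =>
    if (PP t ∧ t (Fin.last r) < m) ∧ m = n then
        (∏ i, ((t i : ENNReal) ^ (k i))⁻¹) * (m : ENNReal)⁻¹ else 0), tsum_eq_single n]
  · rw [← Summable.tsum_finsetSum (fun _ _ => ENNReal.summable), div_eq_mul_inv,
      ← ENNReal.tsum_mul_right]
    apply tsum_congr
    intro t
    by_cases h : PP t
    · simp only [h, true_and, and_true, Finset.sum_ite_eq, Finset.mem_range]
      split_ifs <;> simp
    · simp [h]
  · intro m hm
    simp [hm]

open Classical in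
lemma W_x (r : ℕ) (k : Fin (r + 1) → ℕ) (n : ℕ) :
    W r (fun i => if i = Fin.last r then k i + 1 else k i) n = if n = 0 then 0 else W r k n / n := by
  split_ifs with hn
  · subst hn
    unfold W
    simp only [ENNReal.tsum_eq_zero]
    intro t
    rw [if_neg]
    rintro ⟨h1, h2⟩
    have := h1.1 (Fin.last r)
    omega
  · unfold W
    rw [div_eq_mul_inv, ← ENNReal.tsum_mul_right]
    apply tsum_congr
    intro t
    split_ifs with h
    · rw [Fin.prod_univ_castSucc, Fin.prod_univ_castSucc, mul_assoc]
      congr 1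
      · apply Finset.prod_congr rfl
        intro i _
        beta_reduce
        rw [if_neg (Fin.castSucc_lt_last i).ne]
      · beta_reduce
        rw [if_pos rfl, h.2, pow_succ, ENNReal.mul_inv (Or.inr (by simp)) (Or.inr (by simpa using hn))]
    · simp

open Classical in
lemma W_base (n : ℕ) : W 0 (fun _ => 1) n = if n = 0 then 0 else (1 : ENNReal) / n := by
  unfold W
  rw [tsum_eq_single (fun _ => n)]
  · have : PP (fun _ : Fin 1 => n) ↔ n ≠ 0 := by
      constructor
      · intro h; have := h.1 0; simp at this; omega
      · intro h; exact ⟨fun _ => Nat.pos_of_ne_zero h, fun i j hij => absurd hij (by omega)⟩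
    by_cases h : n = 0
    · rw [if_neg (by rw [this]; simp [h]), if_pos h]
    · rw [if_pos ⟨this.2 h, rfl⟩, if_neg h]; simp
  · intro t ht
    rw [if_neg]
    rintro ⟨_, h⟩
    apply ht
    funext i
    rw [← h]; congr 1; exact Fin.ext (by simp)

lemma W_sum (r : ℕ) (k : Fin (r + 1) → ℕ) : (∑' n, W r k n).toReal = MZV (r + 1) k := by
  classical
  unfold W
  rw [ENNReal.tsum_comm]
  have e : ∀ t : Fin (r + 1) → ℕ,
      (∑' n, if PP t ∧ t (Fin.last r) = n then ∏ i, ((t i : ENNReal) ^ (k i))⁻¹ else 0) =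
      Set.indicator {t : Fin (r + 1) → ℕ | PP t} (fun t => ∏ i, ((t i : ENNReal) ^ (k i))⁻¹) t := by
    intro t
    rw [tsum_eq_single (t (Fin.last r))]
    · simp [Set.indicator]
    · intro n hn; rw [if_neg]; rintro ⟨_, h⟩; exact hn h.symm
  rw [tsum_congr e, ← tsum_subtype, ENNReal.tsum_toReal_eq]
  · apply tsum_congr
    rintro ⟨t, ht⟩
    rw [ENNReal.toReal_prod]
    apply Finset.prod_congr rfl
    intro i _
    simp
  · rintro ⟨t, ht⟩
    apply ENNReal.prod_ne_top
    intro i _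
    have := ht.1 i
    simp; intro h; omega

lemma word_W (l : List Bool) : good l → l ≠ [] → ∃ (r : ℕ) (k : Fin (r + 1) → ℕ),
    (∀ i, 1 ≤ k i) ∧ wd l.reverse = (List.ofFn fun i => Hy * Hx ^ (k i - 1)).prod ∧
    (∀ n, aE l n = W r k n) ∧ (∀ l', l = false :: l' → 2 ≤ k (Fin.last r)) := by
  induction l with
  | nil => intro _ h; exact absurd rfl h
  | cons b l ih =>
    intro hg _
    cases l with
    | nil =>
      have : b = true := hg
      subst this
      refine ⟨0, fun _ => 1, fun _ => le_rfl, ?_, ?_, ?_⟩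
      · simp [wd_true]
      · intro n
        rw [W_base]
        simp only [aE]
        split_ifs with h
        · rfl
        · congr 1
          rw [Finset.sum_ite_eq', if_pos (by simp; omega)]
      · intro l' h; simp at h
    | cons c l =>
      obtain ⟨r, k, h1, h2, h3, h4⟩ := ih hg (by simp)
      cases b with
      | false =>
        refine ⟨r, fun i => if i = Fin.last r then k i + 1 else k i, ?_, ?_, ?_, ?_⟩
        · intro i; have := h1 i; beta_reduce; split_ifs <;> omega
        · rw [List.reverse_cons, wd_append, h2, wd_false, List.ofFn_succ', List.ofFn_succ']
          simp only [List.concat_eq_append, List.prod_append, List.prod_singleton, mul_assoc]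
          congr 1
          · congr 2
            funext i
            rw [if_neg (Fin.castSucc_lt_last i).ne]
          · congr 1
            simp only [if_true]
            rw [← pow_succ]
            congr 1
            have := h1 (Fin.last r)
            omega
        · intro n
          rw [W_x]; simp only [aE]; rw [← h3]
        · intro l' _; simp; exact h1 _
      | true =>
        refine ⟨r + 1, Fin.snoc k 1, ?_, ?_, ?_, ?_⟩
        · intro i
          refine Fin.lastCases ?_ (fun j => ?_) i
          · simp
          · simpa using h1 j
        · rw [List.reverse_cons, wd_append, h2, wd_true, List.ofFn_succ' (n := r + 1)]
          simp only [List.concat_eq_append, List.prod_append, List.prod_singleton,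
            Fin.snoc_castSucc, Fin.snoc_last]
          simp
        · intro n
          rw [W_snoc]
          simp only [← h3]
          cases n with
          | zero => simp [aE]
          | succ n => rw [aE]; simp
        · intro l' h; simp at h

lemma Z_word (Z : H →ₗ[ℚ] ℝ) (hZ : IsZetaMap Z) (l : List Bool) (hl : good (false :: l)) :
    Z (wd (false :: l).reverse) = (∑' n, aE (false :: l) n).toReal := by
  obtain ⟨r, k, h1, h2, h3, h4⟩ := word_W _ hl (by simp)
  rw [h2, hZ r k h1 (h4 l rfl), tsum_congr h3, W_sum]

/-! ### Part three c : Tonelli -/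

/-- the dual iterated integrals -/
def GE (B : List Bool) (l : ℝ) : ENNReal := FE (B.map (! ·)) (-l)

lemma GE_meas (B : List Bool) : Measurable (GE B) := (FE_meas _).comp measurable_neg

open MeasureTheory in
lemma omE_neg (b : Bool) (m : ℝ) : omE b (-m) = omE (!b) m := by rw [omE, omE, om_neg]

open MeasureTheory in
lemma GE_cons (b : Bool) (B : List Bool) (l : ℝ) :
    GE (b :: B) l = ∫⁻ m in Set.Ioi l, GE B m * omE b m := by
  simp only [GE, List.map_cons, FE]
  rw [← lintegral_indicator measurableSet_Iio, ← lintegral_indicator measurableSet_Ioi,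
    ← lintegral_neg_eq_self]
  congr 1
  funext m
  simp only [Set.indicator, Set.mem_Iio, Set.mem_Ioi, omE_neg, Bool.not_not, neg_lt_neg_iff]

open MeasureTheory in
lemma tonelli (u v : ℝ → ENNReal) (hu : Measurable u) (hv : Measurable v) :
    ∫⁻ x, u x * (∫⁻ m in Set.Ioi x, v m) = ∫⁻ m, (∫⁻ x in Set.Iio m, u x) * v m := by
  have hm : Measurable (fun p : ℝ × ℝ => if p.1 < p.2 then u p.1 * v p.2 else 0) :=
    Measurable.ite (measurableSet_lt measurable_fst measurable_snd)
      ((hu.comp measurable_fst).mul (hv.comp measurable_snd)) measurable_const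
  have e1 : ∀ x, u x * (∫⁻ m in Set.Ioi x, v m) = ∫⁻ m, if x < m then u x * v m else 0 := by
    intro x
    rw [← lintegral_const_mul _ hv, ← lintegral_indicator measurableSet_Ioi]
    congr 1
  have e2 : ∀ m, (∫⁻ x in Set.Iio m, u x) * v m = ∫⁻ x, if x < m then u x * v m else 0 := by
    intro x
    rw [← lintegral_mul_const _ hu, ← lintegral_indicator measurableSet_Iio]
    congr 1
  simp only [e1, e2]
  exact lintegral_lintegral_swap hm.aemeasurable

open MeasureTheory in
lemma int_step (a B : List Bool) (c b : Bool) :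
    ∫⁻ m, FE a m * omE c m * GE (b :: B) m = ∫⁻ m, FE (c :: a) m * omE b m * GE B m := by
  simp only [GE_cons]
  rw [tonelli (fun m => FE a m * omE c m) (fun m => GE B m * omE b m)
    ((FE_meas a).mul (omE_meas c)) ((GE_meas B).mul (omE_meas b))]
  congr 1
  funext m
  simp only [FE]; ring

open MeasureTheory in
lemma Z_int (Z : H →ₗ[ℚ] ℝ) (hZ : IsZetaMap Z) (B : List Bool) : ∀ (a : List Bool) (c : Bool),
    good a → a ≠ [] → (c :: B).getLast? = some false →
    Z (wd (a.reverse ++ c :: B)) = (∫⁻ m, FE a m * omE c m * GE B m).toReal := by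
  induction B with
  | nil =>
    intro a c ha ha0 hc
    have : c = false := by simpa using hc
    subst this
    match a, ha0 with
    | b :: l, _ =>
      have e : (b :: l).reverse ++ [false] = (false :: b :: l).reverse := by simp
      rw [e, Z_word Z hZ (b :: l) (show good (false :: b :: l) from ha), ← FE_total _ _ ha]
      simp [GE, FE]
  | cons b B ih =>
    intro a c ha ha0 hc
    rw [int_step]
    have e : a.reverse ++ c :: b :: B = (c :: a).reverse ++ b :: B := by simp
    rw [e]
    apply ih
    · match a, ha0 with
      | d :: l, _ => exact ha
    · simp
    · rw [List.getLast?_cons_cons] at hc; exact hc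

open MeasureTheory in
/-- integration from `-∞` -/
def JE (f : ℝ → ENNReal) (x : ℝ) : ENNReal := ∫⁻ m in Set.Iio x, f m

open MeasureTheory in
lemma JE_meas (f : ℝ → ENNReal) : Measurable (JE f) := by
  apply Monotone.measurable
  intro x y h
  exact lintegral_mono_set (Set.Iio_subset_Iio h)

open MeasureTheory in
lemma JE_FE (a : List Bool) : JE (FE a) = FE (false :: a) + FE (true :: a) := by
  funext x
  simp only [JE, FE, Pi.add_apply]
  have hm : Measurable (fun m => FE a m * omE false m) := (FE_meas a).mul (omE_meas false)
  rw [← lintegral_add_left hm]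
  congr 1
  funext m
  rw [← mul_add, omE_add, mul_one]

lemma JE_iter_meas (s : ℕ) (f : ℝ → ENNReal) (hf : Measurable f) : Measurable (JE^[s] f) := by
  cases s with
  | zero => exact hf
  | succ s => rw [Function.iterate_succ_apply']; exact JE_meas _

open MeasureTheory in
lemma JE_iter_add (s : ℕ) (f g : ℝ → ENNReal) (hf : Measurable f) (hg : Measurable g) :
    JE^[s] (f + g) = JE^[s] f + JE^[s] g := by
  induction s with
  | zero => rfl
  | succ s ih =>
    rw [Function.iterate_succ_apply', Function.iterate_succ_apply', Function.iterate_succ_apply',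
      ih]
    funext x
    simp only [JE, Pi.add_apply]
    rw [lintegral_add_left (JE_iter_meas s f hf)]

lemma good_cons (c : Bool) (a : List Bool) (ha : good a) (h0 : a ≠ []) : good (c :: a) := by
  match a, h0 with
  | d :: l, _ => exact ha

open MeasureTheory in
lemma Z_J (Z : H →ₗ[ℚ] ℝ) (hZ : IsZetaMap Z) (B : List Bool) (hB : B.getLast? = some false)
    (hfin : ∀ a, good a → a ≠ [] → ∫⁻ m, FE a m * GE B m ≠ ⊤) (s : ℕ) :
    ∀ a : List Bool, good a → a ≠ [] →
    ∫⁻ m, (JE^[s] (FE a)) m * GE B m ≠ ⊤ ∧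
    Z (wd a.reverse * (Hx + Hy) ^ (s + 1) * wd B) = (∫⁻ m, (JE^[s] (FE a)) m * GE B m).toReal := by
  induction s with
  | zero =>
    intro a ha h0
    refine ⟨hfin a ha h0, ?_⟩
    have e : wd a.reverse * (Hx + Hy) ^ (0 + 1) * wd B =
        wd (a.reverse ++ false :: B) + wd (a.reverse ++ true :: B) := by
      rw [wd_append, wd_append, wd_cons, wd_cons, zero_add, pow_one]
      change _ = wd a.reverse * (Hx * wd B) + wd a.reverse * (Hy * wd B)
      noncomm_ring
    have hB0 : ∀ c, (c :: B).getLast? = some false := by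
      intro c
      cases B with
      | nil => simp at hB
      | cons b B => rw [List.getLast?_cons_cons]; exact hB
    have hsplit : ∫⁻ m, FE a m * GE B m =
        (∫⁻ m, FE a m * omE false m * GE B m) + (∫⁻ m, FE a m * omE true m * GE B m) := by
      have hm : Measurable (fun m => FE a m * omE false m * GE B m) :=
        ((FE_meas a).mul (omE_meas false)).mul (GE_meas B)
      rw [← lintegral_add_left hm]
      congr 1
      funext m
      rw [← add_mul, ← mul_add, omE_add, mul_one]
    have hf := hfin a ha h0
    simp only [Function.iterate_zero, id_eq]
    rw [e, map_add, Z_int Z hZ B a false ha h0 (hB0 _), Z_int Z hZ B a true ha h0 (hB0 _), hsplit,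
      ENNReal.toReal_add]
    · intro h; apply hf; rw [hsplit, h]; simp
    · intro h; apply hf; rw [hsplit, h]; simp
  | succ s ih =>
    intro a ha h0
    have i1 := ih (false :: a) (good_cons _ a ha h0) (by simp)
    have i2 := ih (true :: a) (good_cons _ a ha h0) (by simp)
    have hsplit : ∫⁻ m, (JE^[s + 1] (FE a)) m * GE B m =
        (∫⁻ m, (JE^[s] (FE (false :: a))) m * GE B m) +
          (∫⁻ m, (JE^[s] (FE (true :: a))) m * GE B m) := by
      have hm : Measurable (fun m => (JE^[s] (FE (false :: a))) m * GE B m) :=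
        (JE_iter_meas s _ (FE_meas _)).mul (GE_meas B)
      rw [← lintegral_add_left hm]
      congr 1
      funext m
      rw [Function.iterate_succ_apply, JE_FE, JE_iter_add _ _ _ (FE_meas _) (FE_meas _)]
      simp only [Pi.add_apply, add_mul]
    rw [hsplit]
    refine ⟨ENNReal.add_ne_top.2 ⟨i1.1, i2.1⟩, ?_⟩
    rw [ENNReal.toReal_add i1.1 i2.1, ← i1.2, ← i2.2, ← map_add]
    congr 1
    rw [List.reverse_cons, List.reverse_cons, wd_append, wd_append, wd_true, wd_false,
      pow_succ' _ (s + 1)]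
    noncomm_ring

open MeasureTheory in
/-- correlation -/
def Cv (f g : ℝ → ENNReal) (r : ℝ) : ENNReal := ∫⁻ l, f (l - r) * g l

open MeasureTheory in
lemma Cv_meas (f g : ℝ → ENNReal) (hf : Measurable f) (hg : Measurable g) : Measurable (Cv f g) := by
  unfold Cv
  apply Measurable.lintegral_prod_right' (f := fun p : ℝ × ℝ => f (p.2 - p.1) * g p.2)
  exact (hf.comp (measurable_snd.sub measurable_fst)).mul (hg.comp measurable_snd)

open MeasureTheory in
lemma Cv_JE (f g : ℝ → ENNReal) (hf : Measurable f) (hg : Measurable g) (r : ℝ) :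
    Cv (JE f) g r = ∫⁻ t in Set.Ioi r, Cv f g t := by
  have hm : Measurable (fun p : ℝ × ℝ => if r < p.2 then f (p.1 - p.2) * g p.1 else 0) :=
    Measurable.ite (measurableSet_lt measurable_const measurable_snd)
      ((hf.comp (measurable_fst.sub measurable_snd)).mul (hg.comp measurable_fst)) measurable_const
  have e1 : ∀ l, JE f (l - r) * g l = ∫⁻ t, if r < t then f (l - t) * g l else 0 := by
    intro l
    unfold JE
    rw [← lintegral_mul_const _ hf, ← lintegral_indicator measurableSet_Iio,
      ← lintegral_sub_left_eq_self _ l]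
    congr 1
    funext t
    simp only [Set.indicator, Set.mem_Iio, sub_lt_sub_iff_left]
  have e2 : ∫⁻ t in Set.Ioi r, Cv f g t = ∫⁻ t, ∫⁻ l, if r < t then f (l - t) * g l else 0 := by
    rw [← lintegral_indicator measurableSet_Ioi]
    congr 1
    funext t
    simp only [Set.indicator, Set.mem_Ioi]
    split_ifs
    · rfl
    · simp
  rw [e2, Cv]
  simp only [e1]
  exact lintegral_lintegral_swap hm.aemeasurable

/-! ### Part three d : iterated integration of expansions -/

/-- main terms -/
def EE (N : ℕ) (a b : ℕ → ℝ) (s : ℕ) (r : ℝ) : ℝ :=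
  ∑ k ∈ Finset.range N, (a k + b k * s / (k + 1) + b k * r) / ((k : ℝ) + 1) ^ s *
    Real.exp (-((k : ℝ) + 1) * r)

lemma EE_cont (N : ℕ) (a b : ℕ → ℝ) (s : ℕ) : Continuous (EE N a b s) := by
  unfold EE; fun_prop

lemma EE_bound (N : ℕ) (a b : ℕ → ℝ) (s : ℕ) : ∃ K, 0 ≤ K ∧ ∀ t, 0 ≤ t →
    |EE N a b s t| ≤ K * Real.exp (-(1/2) * t) := by
  refine ⟨∑ k ∈ Finset.range N, (|a k + b k * s / (k + 1)| + 2 * |b k|) / ((k : ℝ) + 1) ^ s,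
    Finset.sum_nonneg (fun k _ => by positivity), ?_⟩
  intro t ht
  unfold EE
  refine (Finset.abs_sum_le_sum_abs _ _).trans ?_
  rw [Finset.sum_mul]
  refine Finset.sum_le_sum (fun k _ => ?_)
  have hp : (0 : ℝ) < ((k : ℝ) + 1) ^ s := by positivity
  rw [abs_mul, abs_div, abs_of_pos hp, abs_of_pos (Real.exp_pos _), div_mul_eq_mul_div,
    div_mul_eq_mul_div]
  apply div_le_div_of_nonneg_right _ hp.le
  have h1 : |a k + b k * s / (k + 1) + b k * t| ≤ |a k + b k * s / (k + 1)| + |b k| * t := by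
    refine (abs_add_le _ _).trans ?_
    rw [abs_mul, abs_of_nonneg ht]
  have h2 : t ≤ 2 * Real.exp (1/2 * t) := by
    have := Real.add_one_le_exp (1/2 * t); linarith
  have h3 : 1 ≤ Real.exp (1/2 * t) := Real.one_le_exp (by positivity)
  have h4 : Real.exp (-((k : ℝ) + 1) * t) ≤ Real.exp (-(1/2) * t) * Real.exp (-(1/2) * t) := by
    rw [← Real.exp_add]
    apply Real.exp_le_exp.2
    have : 0 ≤ (k : ℝ) * t := by positivity
    nlinarith
  have h5 : Real.exp (1/2 * t) * Real.exp (-(1/2) * t) = 1 := by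
    rw [← Real.exp_add]; simp
  have h6 := Real.exp_pos (-(1/2) * t)
  calc |a k + b k * s / (k + 1) + b k * t| * Real.exp (-((k : ℝ) + 1) * t)
      ≤ ((|a k + b k * s / (k + 1)| + 2 * |b k|) * Real.exp (1/2 * t)) *
        (Real.exp (-(1/2) * t) * Real.exp (-(1/2) * t)) := by
        apply mul_le_mul _ h4 (Real.exp_pos _).le (by positivity)
        refine h1.trans ?_
        nlinarith [abs_nonneg (a k + b k * s / (k + 1)), abs_nonneg (b k)]
    _ = (|a k + b k * s / (k + 1)| + 2 * |b k|) *
        ((Real.exp (1/2 * t) * Real.exp (-(1/2) * t)) * Real.exp (-(1/2) * t)) := by ring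
    _ = _ := by rw [h5, one_mul]

lemma EE_deriv (N : ℕ) (a b : ℕ → ℝ) (s : ℕ) (r : ℝ) :
    HasDerivAt (fun r => - EE N a b (s + 1) r) (EE N a b s r) r := by
  unfold EE
  have : ∀ k ∈ Finset.range N, HasDerivAt (fun r => (a k + b k * (s + 1 : ℕ) / (k + 1) + b k * r) /
      ((k : ℝ) + 1) ^ (s + 1) * Real.exp (-((k : ℝ) + 1) * r))
      (- ((a k + b k * s / (k + 1) + b k * r) / ((k : ℝ) + 1) ^ s *
        Real.exp (-((k : ℝ) + 1) * r))) r := by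
    intro k _
    have hk : (k : ℝ) + 1 ≠ 0 := by positivity
    have h1 : HasDerivAt (fun r : ℝ => Real.exp (-((k : ℝ) + 1) * r))
        (Real.exp (-((k : ℝ) + 1) * r) * (-((k : ℝ) + 1))) r := by
      have := ((hasDerivAt_id r).const_mul (-((k : ℝ) + 1))).exp
      simpa using this
    have h2 : HasDerivAt (fun r : ℝ => (a k + b k * (s + 1 : ℕ) / (k + 1) + b k * r) /
      ((k : ℝ) + 1) ^ (s + 1)) (b k / ((k : ℝ) + 1) ^ (s + 1)) r := by
      have := (((hasDerivAt_id r).const_mul (b k)).const_add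
        (a k + b k * (s + 1 : ℕ) / (k + 1))).div_const (((k : ℝ) + 1) ^ (s + 1))
      simpa using this
    refine (h2.mul h1).congr_deriv ?_
    rw [pow_succ]
    push_cast
    field_simp
    ring
  refine (HasDerivAt.fun_sum this).neg.congr_deriv ?_
  simp

open MeasureTheory in
lemma EE_intOn (N : ℕ) (a b : ℕ → ℝ) (s : ℕ) (r : ℝ) (hr : 0 ≤ r) :
    IntegrableOn (EE N a b s) (Set.Ioi r) := by
  obtain ⟨K, _, hK⟩ := EE_bound N a b s
  have h := (integrableOn_exp_mul_Ioi (show (-(1/2) : ℝ) < 0 by norm_num) r).const_mul K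
  refine h.mono' (EE_cont N a b s).aestronglyMeasurable ?_
  filter_upwards [ae_restrict_mem measurableSet_Ioi] with t ht
  exact hK t (hr.trans (le_of_lt ht))

open MeasureTheory in
lemma EE_int (N : ℕ) (a b : ℕ → ℝ) (s : ℕ) (r : ℝ) (hr : 0 ≤ r) :
    ∫ t in Set.Ioi r, EE N a b s t = EE N a b (s + 1) r := by
  have ht : Filter.Tendsto (fun r => - EE N a b (s + 1) r) Filter.atTop (nhds 0) := by
    obtain ⟨K, _, hK⟩ := EE_bound N a b (s + 1)
    have h0 : Filter.Tendsto (fun t : ℝ => K * Real.exp (-(1/2) * t)) Filter.atTop (nhds 0) := by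
      have h1 : Filter.Tendsto (fun t : ℝ => -(1/2) * t) Filter.atTop Filter.atBot :=
        Filter.tendsto_id.const_mul_atTop_of_neg (by norm_num)
      simpa using (Real.tendsto_exp_atBot.comp h1).const_mul K
    refine squeeze_zero_norm' ?_ h0
    filter_upwards [Filter.eventually_ge_atTop 0] with t ht
    rw [norm_neg]; exact hK t ht
  have := integral_Ioi_of_hasDerivAt_of_tendsto' (a := r)
    (fun x _ => EE_deriv N a b s x) (EE_intOn N a b s r hr) ht
  rw [this]; ring

open MeasureTheory in
lemma iter_exp (h : ℕ → ℝ → ENNReal) (hm : ∀ s, Measurable (h s))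
    (hs : ∀ s r, h (s + 1) r = ∫⁻ t in Set.Ioi r, h s t) (N : ℕ) (a b : ℕ → ℝ) (C : ℝ)
    (h0 : ∀ r, 0 ≤ r → h 0 r ≠ ⊤)
    (h1 : ∀ r, 0 ≤ r → |(h 0 r).toReal - EE N a b 0 r| ≤ C * Real.exp (-((N : ℝ) + 1/2) * r))
    (s : ℕ) : ∀ r, 0 ≤ r → h s r ≠ ⊤ ∧
      |(h s r).toReal - EE N a b s r| ≤ C / ((N : ℝ) + 1/2) ^ s * Real.exp (-((N : ℝ) + 1/2) * r) := by
  have hth : (0 : ℝ) < (N : ℝ) + 1/2 := by positivity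
  induction s with
  | zero => intro r hr; exact ⟨h0 r hr, by simpa using h1 r hr⟩
  | succ s ih =>
    intro r hr
    have hexp := (integrableOn_exp_mul_Ioi (show -((N : ℝ) + 1/2) < 0 by linarith) r).const_mul
      (C / ((N : ℝ) + 1/2) ^ s)
    have hE := EE_intOn N a b s r hr
    have hmr : Measurable (fun t => (h s t).toReal) := (hm s).ennreal_toReal
    have hd : IntegrableOn (fun t => (h s t).toReal - EE N a b s t) (Set.Ioi r) := by
      refine Integrable.mono' hexp
        (hmr.aestronglyMeasurable.sub (EE_cont N a b s).aestronglyMeasurable) ?_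
      filter_upwards [ae_restrict_mem measurableSet_Ioi] with t ht
      exact (ih t (hr.trans (le_of_lt ht))).2
    have hH : IntegrableOn (fun t => (h s t).toReal) (Set.Ioi r) := by
      have := hd.add hE
      refine this.congr (Filter.Eventually.of_forall (fun t => ?_))
      simp
    have e1 : h (s + 1) r = ENNReal.ofReal (∫ t in Set.Ioi r, (h s t).toReal) := by
      rw [hs, ofReal_integral_eq_lintegral_ofReal hH
        (Filter.Eventually.of_forall (fun t => ENNReal.toReal_nonneg))]
      refine setLIntegral_congr_fun measurableSet_Ioi (fun t ht => ?_)
      exact (ENNReal.ofReal_toReal (ih t (hr.trans (le_of_lt ht))).1).symm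
    refine ⟨by rw [e1]; exact ENNReal.ofReal_ne_top, ?_⟩
    rw [e1, ENNReal.toReal_ofReal (integral_nonneg (fun t => ENNReal.toReal_nonneg)),
      ← EE_int N a b s r hr, ← integral_sub hH hE]
    have := norm_integral_le_of_norm_le hexp (f := fun t => (h s t).toReal - EE N a b s t) (by
      filter_upwards [ae_restrict_mem measurableSet_Ioi] with t ht
      exact (ih t (hr.trans (le_of_lt ht))).2)
    rw [Real.norm_eq_abs] at this
    refine this.trans (le_of_eq ?_)
    rw [integral_const_mul, integral_exp_mul_Ioi (by linarith)]
    rw [pow_succ]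
    field_simp

/-! ### Part three e : expansions of the iterated integrals -/

/-- functions with an expansion in `e^{kx}` as `x → -∞` and of slow growth as `x → ∞` -/
def Cls (F : ℝ → ℝ) (α : ℕ → ℝ) : Prop :=
  (∀ N : ℕ, ∃ C, 0 ≤ C ∧ ∀ x, x ≤ 0 →
    |F x - ∑ k ∈ Finset.range N, α k * Real.exp (k * x)| ≤ C * Real.exp (N * x)) ∧
  ∃ C, 0 ≤ C ∧ ∀ x, 0 ≤ x → |F x| ≤ C * Real.exp (x / 4)

lemma Cls_one : Cls (fun _ => 1) (fun k => if k = 0 then 1 else 0) := by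
  refine ⟨fun N => ⟨1, zero_le_one, fun x hx => ?_⟩, 1, zero_le_one, fun x hx => ?_⟩
  · cases N with
    | zero => simp
    | succ N =>
      rw [Finset.sum_range_succ']
      simp [Real.exp_nonneg]
  · rw [abs_one, one_mul]; exact Real.one_le_exp (by positivity)

lemma Cls_sub {F G : ℝ → ℝ} {α β : ℕ → ℝ} (hF : Cls F α) (hG : Cls G β) :
    Cls (fun x => F x - G x) (fun k => α k - β k) := by
  obtain ⟨h1, C1, c1, g1⟩ := hF
  obtain ⟨h2, C2, c2, g2⟩ := hG
  refine ⟨fun N => ?_, C1 + C2, add_nonneg c1 c2, fun x hx => ?_⟩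
  · obtain ⟨K1, k1, f1⟩ := h1 N
    obtain ⟨K2, k2, f2⟩ := h2 N
    refine ⟨K1 + K2, add_nonneg k1 k2, fun x hx => ?_⟩
    have e : F x - G x - ∑ k ∈ Finset.range N, (α k - β k) * Real.exp (k * x) =
        (F x - ∑ k ∈ Finset.range N, α k * Real.exp (k * x)) -
        (G x - ∑ k ∈ Finset.range N, β k * Real.exp (k * x)) := by
      simp only [sub_mul, Finset.sum_sub_distrib]; ring
    rw [e, add_mul]
    exact (abs_sub _ _).trans (add_le_add (f1 x hx) (f2 x hx))
  · rw [add_mul]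
    exact (abs_sub _ _).trans (add_le_add (g1 x hx) (g2 x hx))

lemma Cls_mul_om {F : ℝ → ℝ} {α α' : ℕ → ℝ} (hF : Cls F α) (h0 : α' 0 = 0)
    (h' : ∀ k, α' (k + 1) = α k - α' k) : Cls (fun x => F x * om true x) α' := by
  obtain ⟨h1, C1, c1, g1⟩ := hF
  refine ⟨fun N => ?_, C1, c1, fun x hx => ?_⟩
  · have hid : ∀ (N : ℕ) (x : ℝ), (1 + Real.exp x) *
        (∑ k ∈ Finset.range (N + 1), α' k * Real.exp (k * x)) =
        Real.exp x * (∑ k ∈ Finset.range N, α k * Real.exp (k * x)) +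
          α' N * Real.exp ((N + 1 : ℕ) * x) := by
      intro N x
      induction N with
      | zero => simp [h0]
      | succ N ih =>
        rw [Finset.sum_range_succ, mul_add, ih, Finset.sum_range_succ, h']
        have e1 : Real.exp ((N + 1 : ℕ) * x) = Real.exp x * Real.exp (N * x) := by
          rw [← Real.exp_add]; push_cast; ring_nf
        have e2 : Real.exp ((N + 1 + 1 : ℕ) * x) = Real.exp x * (Real.exp x * Real.exp (N * x)) := by
          rw [← Real.exp_add, ← Real.exp_add]; push_cast; ring_nf
        rw [e1, e2]; ring
    cases N with
    | zero =>
      obtain ⟨K, k0, f⟩ := h1 0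
      refine ⟨K, k0, fun x hx => ?_⟩
      have := f x hx
      simp only [Finset.range_zero, Finset.sum_empty, sub_zero] at this ⊢
      rw [abs_mul, abs_of_pos (om_pos _ _)]
      exact (mul_le_of_le_one_right (abs_nonneg _) (om_le_one _ _)).trans this
    | succ N =>
      obtain ⟨K, k0, f⟩ := h1 N
      refine ⟨K + |α' N|, by positivity, fun x hx => ?_⟩
      have hp : 0 < 1 + Real.exp x := by positivity
      have e : F x * om true x - ∑ k ∈ Finset.range (N + 1), α' k * Real.exp (k * x) =
          (Real.exp x * (F x - ∑ k ∈ Finset.range N, α k * Real.exp (k * x)) -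
          α' N * Real.exp ((N + 1 : ℕ) * x)) / (1 + Real.exp x) := by
        rw [eq_div_iff hp.ne', sub_mul, mul_comm (∑ k ∈ Finset.range (N + 1), _), hid]
        simp only [om, if_true]
        generalize (∑ k ∈ Finset.range N, α k * Real.exp (k * x)) = S
        field_simp
        ring
      have e1 : Real.exp ((N + 1 : ℕ) * x) = Real.exp x * Real.exp (N * x) := by
        rw [← Real.exp_add]; push_cast; ring_nf
      rw [e, abs_div, abs_of_pos hp]
      refine (div_le_self (abs_nonneg _) (by linarith [Real.exp_pos x])).trans ?_
      refine (abs_sub _ _).trans ?_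
      rw [abs_mul, abs_mul, abs_of_pos (Real.exp_pos _), abs_of_pos (Real.exp_pos _), add_mul]
      apply add_le_add _ le_rfl
      rw [e1]
      have := mul_le_mul_of_nonneg_left (f x hx) (Real.exp_pos x).le
      linarith
  · rw [abs_mul, abs_of_pos (om_pos _ _)]
    exact (mul_le_of_le_one_right (abs_nonneg _) (om_le_one _ _)).trans (g1 x hx)

lemma Cls_bd {F : ℝ → ℝ} {α : ℕ → ℝ} (hF : Cls F α) (h0 : α 0 = 0) :
    ∃ K, 0 ≤ K ∧ (∀ x, |F x| ≤ K * Real.exp (x / 4)) ∧ (∀ x, |F x| ≤ K * Real.exp x) := by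
  obtain ⟨h1, C1, c1, g1⟩ := hF
  obtain ⟨K, k0, f⟩ := h1 1
  refine ⟨C1 + K, by positivity, fun x => ?_, fun x => ?_⟩
  · rw [add_mul]
    have p1 := mul_nonneg c1 (Real.exp_pos (x/4)).le
    have p2 := mul_nonneg k0 (Real.exp_pos (x/4)).le
    rcases le_total x 0 with h | h
    · have := f x h
      simp [h0] at this
      have h3 : Real.exp x ≤ Real.exp (x / 4) := Real.exp_le_exp.2 (by linarith)
      have := mul_le_mul_of_nonneg_left h3 k0
      linarith
    · linarith [g1 x h]
  · rw [add_mul]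
    have p1 := mul_nonneg c1 (Real.exp_pos x).le
    have p2 := mul_nonneg k0 (Real.exp_pos x).le
    rcases le_total x 0 with h | h
    · have := f x h
      simp [h0] at this
      linarith
    · have h3 : Real.exp (x / 4) ≤ Real.exp x := Real.exp_le_exp.2 (by linarith)
      have := mul_le_mul_of_nonneg_left h3 c1
      linarith [g1 x h]

open MeasureTheory in
lemma Cls_intOn {F : ℝ → ℝ} {α : ℕ → ℝ} (hF : Cls F α) (h0 : α 0 = 0) (hm : Measurable F) (x : ℝ) :
    IntegrableOn F (Set.Iic x) := by
  obtain ⟨K, k0, b1, b2⟩ := Cls_bd hF h0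
  have h := (integrableOn_exp_mul_Iic (show (0 : ℝ) < 1 by norm_num) x).const_mul K
  refine h.mono' hm.aestronglyMeasurable (Filter.Eventually.of_forall (fun t => ?_))
  simpa using b2 t

open MeasureTheory in
lemma Cls_J {F : ℝ → ℝ} {α : ℕ → ℝ} (hF : Cls F α) (h0 : α 0 = 0) (hm : Measurable F) :
    Cls (fun x => ∫ m in Set.Iic x, F m) (fun k => α k / k) := by
  obtain ⟨K, k0, b1, b2⟩ := Cls_bd hF h0
  have hg : ∀ x, |∫ m in Set.Iic x, F m| ≤ 4 * K * Real.exp (x / 4) := by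
    intro x
    have hi := (integrableOn_exp_mul_Iic (show (0 : ℝ) < 1/4 by norm_num) x).const_mul K
    have := norm_integral_le_of_norm_le hi (f := F)
      (Filter.Eventually.of_forall (fun t => by
        rw [Real.norm_eq_abs]; have := b1 t; rwa [show t / 4 = 1/4 * t by ring] at this))
    rw [integral_const_mul, integral_exp_mul_Iic (by norm_num), Real.norm_eq_abs] at this
    refine this.trans (le_of_eq ?_)
    rw [show x / 4 = 1/4 * x by ring]; ring
  refine ⟨fun N => ?_, 4 * K, by positivity, fun x hx => hg x⟩
  cases N with
  | zero =>
    refine ⟨4 * K, by positivity, fun x hx => ?_⟩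
    have h3 : Real.exp (x / 4) ≤ 1 := Real.exp_le_one_iff.2 (by linarith)
    have := mul_le_mul_of_nonneg_left h3 (show 0 ≤ 4 * K by positivity)
    simpa using (hg x).trans this
  | succ N =>
    obtain ⟨C, c0, f⟩ := hF.1 (N + 1)
    refine ⟨C, c0, fun x hx => ?_⟩
    have hN : (0 : ℝ) < (N + 1 : ℕ) := by positivity
    have hi := (integrableOn_exp_mul_Iic hN x).const_mul C
    have hk : ∀ k ∈ Finset.range (N + 1),
        IntegrableOn (fun t => α k * Real.exp (k * t)) (Set.Iic x) := by
      intro k _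
      rcases Nat.eq_zero_or_pos k with h | h
      · subst h; simp [h0]
      · exact (integrableOn_exp_mul_Iic (by exact_mod_cast h) x).const_mul _
    have hs : ∑ k ∈ Finset.range (N + 1), α k / k * Real.exp (k * x) =
        ∫ t in Set.Iic x, ∑ k ∈ Finset.range (N + 1), α k * Real.exp (k * t) := by
      rw [integral_finsetSum _ hk]
      refine Finset.sum_congr rfl (fun k _ => ?_)
      rcases Nat.eq_zero_or_pos k with h | h
      · subst h; simp [h0]
      · rw [integral_const_mul, integral_exp_mul_Iic (by exact_mod_cast h)]; ring
    rw [hs, ← integral_sub (Cls_intOn hF h0 hm x) (integrable_finsetSum _ hk)]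
    have := norm_integral_le_of_norm_le hi
      (f := fun t => F t - ∑ k ∈ Finset.range (N + 1), α k * Real.exp (k * t)) (by
      filter_upwards [ae_restrict_mem measurableSet_Iic] with t ht
      exact f t (le_trans ht hx))
    rw [integral_const_mul, integral_exp_mul_Iic hN, Real.norm_eq_abs] at this
    refine this.trans ?_
    apply mul_le_mul_of_nonneg_left _ c0
    apply div_le_self (Real.exp_pos _).le
    push_cast; linarith [(Nat.cast_nonneg N : (0:ℝ) ≤ N)]

/-- coefficients of the expansion -/
def al (l : List Bool) (k : ℕ) : ℝ := (-1) ^ k * (hh (phi (wd l.reverse)) k : ℝ)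

lemma hh_phi_false (l : List Bool) (k : ℕ) : hh (phi (wd (false :: l).reverse)) k =
    (hh (phi (wd l.reverse)) k + ∑ m ∈ Finset.range k, hh (phi (wd l.reverse)) m) / k := by
  rw [List.reverse_cons, wd_append, wd_false, map_mul, phi_x, mul_add, map_add, Pi.add_apply,
    hh_x, hh_y, add_div]

lemma hh_phi_true (l : List Bool) (k : ℕ) : hh (phi (wd (true :: l).reverse)) k =
    -(∑ m ∈ Finset.range k, hh (phi (wd l.reverse)) m) / k := by
  rw [List.reverse_cons, wd_append, wd_true, map_mul, phi_y, mul_neg, map_neg, Pi.neg_apply,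
    hh_y, neg_div]

lemma al_zero (l : List Bool) (hl : l ≠ []) : al l 0 = 0 := by
  match l, hl with
  | false :: l, _ => simp [al, -List.reverse_cons, hh_phi_false]
  | true :: l, _ => simp [al, -List.reverse_cons, hh_phi_true]

open MeasureTheory in
lemma FE_Cls (l : List Bool) (hl : good l) :
    (∀ x, FE l x ≠ ⊤) ∧ Cls (fun x => (FE l x).toReal) (al l) := by
  induction l with
  | nil =>
    refine ⟨fun x => by simp [FE], ?_⟩
    have e : al [] = fun k => if k = 0 then 1 else 0 := by
      funext k
      simp only [al, List.reverse_nil, wd_nil, map_one, hh_one]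
      split_ifs with h <;> simp [h]
    rw [e]
    simpa [FE] using Cls_one
  | cons b l ih =>
    obtain ⟨i1, i2⟩ := ih (good_tail hl)
    let α' : ℕ → ℝ := fun k => (-1) ^ (k + 1) *
      (∑ m ∈ Finset.range k, (hh (phi (wd l.reverse)) m : ℝ))
    have hy : Cls (fun x => (FE l x).toReal * om true x) α' := by
      refine Cls_mul_om i2 (by simp [α']) (fun k => ?_)
      simp only [α', al, Finset.sum_range_succ]
      ring
    have hmr : Measurable (fun x => (FE l x).toReal) := (FE_meas l).ennreal_toReal
    have hmm : Measurable (fun x => (FE l x).toReal * om b x) := hmr.mul (om_cont b).measurable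
    obtain ⟨β, hβ, hβ0, hβl⟩ : ∃ β, Cls (fun x => (FE l x).toReal * om b x) β ∧ β 0 = 0 ∧
        (fun k => β k / k) = al (b :: l) := by
      cases b with
      | true =>
        refine ⟨α', hy, by simp [α'], ?_⟩
        funext k
        simp only [α', al, hh_phi_true]
        push_cast
        ring
      | false =>
        refine ⟨fun k => al l k - α' k, ?_, ?_, ?_⟩
        · have := Cls_sub i2 hy
          have e : (fun x => (FE l x).toReal * om false x) =
              fun x => (FE l x).toReal - (FE l x).toReal * om true x := by
            funext x
            rw [← om_add x |> fun h => eq_sub_of_add_eq h |>.symm]; ring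
          rw [e]; exact this
        · have : l ≠ [] := by rintro rfl; simp [good] at hl
          simp [α', al_zero l this]
        · funext k
          simp only [α', al, hh_phi_false]
          push_cast
          ring
    have e : ∀ x, FE (b :: l) x = ENNReal.ofReal (∫ m in Set.Iic x, (FE l m).toReal * om b m) := by
      intro x
      rw [ofReal_integral_eq_lintegral_ofReal (Cls_intOn hβ hβ0 hmm x)
        (Filter.Eventually.of_forall (fun t => mul_nonneg ENNReal.toReal_nonneg (om_pos _ _).le)),
        setLIntegral_congr Iio_ae_eq_Iic.symm]
      simp only [FE]
      congr 1
      funext m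
      rw [ENNReal.ofReal_mul ENNReal.toReal_nonneg, ENNReal.ofReal_toReal (i1 m), omE]
    refine ⟨fun x => by rw [e]; exact ENNReal.ofReal_ne_top, ?_⟩
    have e2 : (fun x => (FE (b :: l) x).toReal) =
        fun x => ∫ m in Set.Iic x, (FE l m).toReal * om b m := by
      funext x
      rw [e, ENNReal.toReal_ofReal]
      exact integral_nonneg (fun t => mul_nonneg ENNReal.toReal_nonneg (om_pos _ _).le)
    rw [e2, ← hβl]
    exact Cls_J hβ hβ0 hmm

/-! ### Part three f : expansion of the correlation -/

/-- existence of an expansion with prescribed coefficients `b` -/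
def Xp (N : ℕ) (h : ℝ → ℝ) (b : ℕ → ℝ) : Prop :=
  ∃ (a : ℕ → ℝ) (C : ℝ), ∀ r, 0 ≤ r → |h r - EE N a b 0 r| ≤ C * Real.exp (-((N : ℝ) + 1/2) * r)

lemma EE_add (N : ℕ) (a b a' b' : ℕ → ℝ) (s : ℕ) (r : ℝ) :
    EE N (fun k => a k + a' k) (fun k => b k + b' k) s r = EE N a b s r + EE N a' b' s r := by
  unfold EE
  rw [← Finset.sum_add_distrib]
  refine Finset.sum_congr rfl (fun k _ => ?_)
  ring

lemma EE_smul (N : ℕ) (c : ℝ) (a b : ℕ → ℝ) (s : ℕ) (r : ℝ) :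
    EE N (fun k => c * a k) (fun k => c * b k) s r = c * EE N a b s r := by
  unfold EE
  rw [Finset.mul_sum]
  refine Finset.sum_congr rfl (fun k _ => ?_)
  ring

lemma Xp_add {N : ℕ} {h h' : ℝ → ℝ} {b b' : ℕ → ℝ} (H1 : Xp N h b) (H2 : Xp N h' b') :
    Xp N (fun r => h r + h' r) (fun k => b k + b' k) := by
  obtain ⟨a, C, f⟩ := H1
  obtain ⟨a', C', f'⟩ := H2
  refine ⟨fun k => a k + a' k, C + C', fun r hr => ?_⟩
  rw [EE_add, add_mul, add_sub_add_comm]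
  exact (abs_add_le _ _).trans (add_le_add (f r hr) (f' r hr))

lemma Xp_smul {N : ℕ} {h : ℝ → ℝ} {b : ℕ → ℝ} (c : ℝ) (H1 : Xp N h b) :
    Xp N (fun r => c * h r) (fun k => c * b k) := by
  obtain ⟨a, C, f⟩ := H1
  refine ⟨fun k => c * a k, |c| * C, fun r hr => ?_⟩
  rw [EE_smul, ← mul_sub, abs_mul, mul_assoc]
  exact mul_le_mul_of_nonneg_left (f r hr) (abs_nonneg _)

lemma Xp_zero (N : ℕ) : Xp N (fun _ => 0) (fun _ => 0) :=
  ⟨fun _ => 0, 0, fun r _ => by simp [EE]⟩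

lemma Xp_sum {N : ℕ} (S : Finset ℕ) (h : ℕ → ℝ → ℝ) (b : ℕ → ℕ → ℝ)
    (H1 : ∀ i ∈ S, Xp N (h i) (b i)) : Xp N (fun r => ∑ i ∈ S, h i r) (fun k => ∑ i ∈ S, b i k) := by
  induction S using Finset.induction_on with
  | empty => simpa using Xp_zero N
  | insert i S hi ih =>
    simp only [Finset.sum_insert hi]
    exact Xp_add (H1 i (by simp)) (ih (fun j hj => H1 j (by simp [hj])))

lemma Xp_congr {N : ℕ} {h : ℝ → ℝ} {b b' : ℕ → ℝ} (H1 : Xp N h b) (hb : ∀ k < N, b k = b' k) :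
    Xp N h b' := by
  obtain ⟨a, C, f⟩ := H1
  refine ⟨a, C, fun r hr => ?_⟩
  have : EE N a b' 0 r = EE N a b 0 r := by
    unfold EE
    refine Finset.sum_congr rfl (fun k hk => ?_)
    rw [hb k (Finset.mem_range.1 hk)]
  rw [this]; exact f r hr

/-- remainder class -/
def Rm (N : ℕ) (f : ℝ → ℝ) : Prop :=
  Measurable f ∧ ∃ C, 0 ≤ C ∧ (∀ x, x ≤ 0 → |f x| ≤ C * Real.exp (((N : ℝ) + 1) * x)) ∧
    ∀ x, 0 ≤ x → |f x| ≤ C * Real.exp (x / 4)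

lemma Rm_zero {N : ℕ} {f : ℝ → ℝ} (h : Rm N f) : Rm 0 f := by
  obtain ⟨hm, C, c0, h1, h2⟩ := h
  refine ⟨hm, C, c0, fun x hx => (h1 x hx).trans ?_, h2⟩
  apply mul_le_mul_of_nonneg_left _ c0
  apply Real.exp_le_exp.2
  have : (N : ℝ) * x ≤ 0 := mul_nonpos_of_nonneg_of_nonpos (by positivity) hx
  push_cast; nlinarith

/-- truncated exponential -/
def ek (k : ℕ) (l : ℝ) : ℝ := if l < 0 then Real.exp (((k : ℝ) + 1) * l) else 0

lemma ek_Rm (k : ℕ) : Rm 0 (ek k) := by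
  refine ⟨?_, 1, zero_le_one, fun x hx => ?_, fun x hx => ?_⟩
  · exact Measurable.ite measurableSet_Iio (by fun_prop) measurable_const
  · unfold ek
    split_ifs with h
    · rw [abs_of_pos (Real.exp_pos _), one_mul]
      apply Real.exp_le_exp.2
      have : (k : ℝ) * x ≤ 0 := mul_nonpos_of_nonneg_of_nonpos (by positivity) hx
      push_cast; nlinarith
    · rw [abs_zero]; positivity
  · unfold ek
    rw [if_neg (not_lt.2 hx), abs_zero]; positivity

open MeasureTheory in
lemma exp_abs_int (c : ℝ) (hc : 0 < c) : Integrable (fun l : ℝ => Real.exp (-c * |l|)) := by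
  rw [← integrableOn_univ, ← Set.Iic_union_Ioi (a := (0 : ℝ))]
  apply IntegrableOn.union
  · refine (integrableOn_exp_mul_Iic hc 0).congr_fun (fun l hl => ?_) measurableSet_Iic
    simp only
    rw [abs_of_nonpos hl]; ring_nf
  · refine (integrableOn_exp_mul_Ioi (show -c < 0 by linarith) 0).congr_fun (fun l hl => ?_)
      measurableSet_Ioi
    simp only
    rw [abs_of_pos hl]

open MeasureTheory in
/-- real correlation -/
def cv (f g : ℝ → ℝ) (r : ℝ) : ℝ := ∫ l, f (l - r) * g (-l)

open MeasureTheory in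
lemma cv_comm (f g : ℝ → ℝ) (r : ℝ) : cv f g r = cv g f r := by
  unfold cv
  rw [← integral_sub_left_eq_self _ volume r]
  congr 1
  funext l
  rw [mul_comm]
  congr 2 <;> ring

lemma Rm_abs {N : ℕ} {f : ℝ → ℝ} (h : Rm N f) : ∃ C, 0 ≤ C ∧ ∀ x,
    |f x| ≤ C * Real.exp (((N : ℝ) + 1/2) * x - |x| / 4) := by
  obtain ⟨hm, C, c0, h1, h2⟩ := h
  refine ⟨C, c0, fun x => ?_⟩
  rcases le_total x 0 with hx | hx
  · refine (h1 x hx).trans (mul_le_mul_of_nonneg_left (Real.exp_le_exp.2 ?_) c0)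
    rw [abs_of_nonpos hx]
    nlinarith
  · refine (h2 x hx).trans (mul_le_mul_of_nonneg_left (Real.exp_le_exp.2 ?_) c0)
    rw [abs_of_nonneg hx]
    have : 0 ≤ (N : ℝ) * x := by positivity
    nlinarith

lemma Rm_pair {N : ℕ} {f g : ℝ → ℝ} (hf : Rm N f) (hg : Rm N g) : ∃ C, 0 ≤ C ∧ ∀ r l,
    |f (l - r) * g (-l)| ≤ C * Real.exp (-((N : ℝ) + 1/2) * r) * Real.exp (-(1/4) * |l|) := by
  obtain ⟨C, c0, h1⟩ := Rm_abs hf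
  obtain ⟨C', c0', h2⟩ := Rm_abs hg
  refine ⟨C * C', by positivity, fun r l => ?_⟩
  rw [abs_mul]
  refine (mul_le_mul (h1 _) (h2 _) (abs_nonneg _) (by positivity)).trans ?_
  rw [mul_mul_mul_comm, mul_assoc (C * C'), ← Real.exp_add, ← Real.exp_add]
  refine mul_le_mul_of_nonneg_left (Real.exp_le_exp.2 ?_) (by positivity)
  rw [abs_neg]
  have := abs_nonneg (l - r)
  nlinarith

open MeasureTheory in
lemma cv_int {f g : ℝ → ℝ} (hf : Rm 0 f) (hg : Rm 0 g) (r : ℝ) :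
    Integrable (fun l => f (l - r) * g (-l)) := by
  obtain ⟨C, c0, h⟩ := Rm_pair hf hg
  refine ((exp_abs_int (1/4) (by norm_num)).const_mul
    (C * Real.exp (-(((0 : ℕ) : ℝ) + 1/2) * r))).mono' ?_ (Filter.Eventually.of_forall (h r))
  exact ((hf.1.comp (measurable_id.sub_const r)).mul
    (hg.1.comp measurable_neg)).aestronglyMeasurable

open MeasureTheory in
lemma Xp_RR {N : ℕ} {f g : ℝ → ℝ} (hf : Rm N f) (hg : Rm N g) : Xp N (cv f g) (fun _ => 0) := by
  obtain ⟨C, c0, h⟩ := Rm_pair hf hg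
  refine ⟨fun _ => 0, C * ∫ l : ℝ, Real.exp (-(1/4) * |l|), fun r hr => ?_⟩
  have e : EE N (fun _ => 0) (fun _ => 0) 0 r = 0 := by simp [EE]
  rw [e, sub_zero]
  have := norm_integral_le_of_norm_le ((exp_abs_int (1/4) (by norm_num)).const_mul
    (C * Real.exp (-((N : ℝ) + 1/2) * r))) (f := fun l => f (l - r) * g (-l)) (Filter.Eventually.of_forall (h r))
  rw [Real.norm_eq_abs] at this
  refine this.trans (le_of_eq ?_)
  rw [integral_const_mul]; ring

open MeasureTheory in
lemma cv_ek (j : ℕ) (g : ℝ → ℝ) (r : ℝ) : cv (ek j) g r =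
    Real.exp (-((j : ℝ) + 1) * r) * ∫ l in Set.Iio r, Real.exp (((j : ℝ) + 1) * l) * g (-l) := by
  unfold cv
  rw [← integral_const_mul, ← integral_indicator measurableSet_Iio]
  congr 1
  funext l
  simp only [ek, Set.indicator, Set.mem_Iio, sub_neg]
  split_ifs
  · rw [← mul_assoc, ← Real.exp_add]; congr 2; ring
  · simp

lemma EE_single (N j : ℕ) (hj : j < N) (κ μ r : ℝ) :
    EE N (fun k => if k = j then κ else 0) (fun k => if k = j then μ else 0) 0 r =
      (κ + μ * r) * Real.exp (-((j : ℝ) + 1) * r) := by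
  unfold EE
  rw [Finset.sum_eq_single_of_mem j (Finset.mem_range.2 hj)]
  · simp
  · intro k _ hk; simp [hk]

open MeasureTheory in
lemma Xp_eR {N j : ℕ} (hj : j < N) {f : ℝ → ℝ} (hf : Rm N f) : Xp N (cv (ek j) f) (fun _ => 0) := by
  obtain ⟨hm, C, c0, h1, h2⟩ := hf
  set g : ℝ → ℝ := fun l => Real.exp (((j : ℝ) + 1) * l) * f (-l) with hg
  have hgm : Measurable g := by
    have : Measurable (fun l : ℝ => Real.exp (((j : ℝ) + 1) * l)) := by fun_prop
    exact this.mul (hm.comp measurable_neg)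
  have hjN : (j : ℝ) + 1 ≤ N := by exact_mod_cast hj
  have b1 : ∀ l, 0 ≤ l → |g l| ≤ C * Real.exp (((j : ℝ) - N) * l) := by
    intro l hl
    simp only [hg]
    rw [abs_mul, abs_of_pos (Real.exp_pos _)]
    refine (mul_le_mul_of_nonneg_left (h1 (-l) (by linarith)) (Real.exp_pos _).le).trans ?_
    rw [mul_left_comm, ← Real.exp_add]
    refine mul_le_mul_of_nonneg_left (Real.exp_le_exp.2 (by nlinarith)) c0
  have b2 : ∀ l, l ≤ 0 → |g l| ≤ C * Real.exp (((j : ℝ) + 3/4) * l) := by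
    intro l hl
    simp only [hg]
    rw [abs_mul, abs_of_pos (Real.exp_pos _)]
    refine (mul_le_mul_of_nonneg_left (h2 (-l) (by linarith)) (Real.exp_pos _).le).trans ?_
    rw [mul_left_comm, ← Real.exp_add]
    refine mul_le_mul_of_nonneg_left (Real.exp_le_exp.2 (by nlinarith)) c0
  have hex : ∀ r : ℝ, 0 ≤ r → IntegrableOn (fun l => C * Real.exp (((j : ℝ) - N) * l)) (Set.Ioi r) :=
    fun r _ => (integrableOn_exp_mul_Ioi (by linarith) r).const_mul C
  have hbI : ∀ r : ℝ, 0 ≤ r → ∀ᵐ l ∂(volume.restrict (Set.Ioi r)),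
      ‖g l‖ ≤ C * Real.exp (((j : ℝ) - N) * l) := by
    intro r hr
    filter_upwards [ae_restrict_mem measurableSet_Ioi] with l hl
    exact b1 l (hr.trans (le_of_lt hl))
  have hgi : Integrable g := by
    rw [← integrableOn_univ, ← Set.Iic_union_Ioi (a := (0 : ℝ))]
    apply IntegrableOn.union
    · refine ((integrableOn_exp_mul_Iic (show (0 : ℝ) < (j : ℝ) + 3/4 by positivity) 0).const_mul
        C).mono' hgm.aestronglyMeasurable ?_
      filter_upwards [ae_restrict_mem measurableSet_Iic] with l hl
      exact b2 l hl
    · exact (hex 0 le_rfl).mono' hgm.aestronglyMeasurable (hbI 0 le_rfl)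
  refine Xp_congr (b := fun k => if k = j then 0 else 0) ?_ (by simp)
  refine ⟨fun k => if k = j then ∫ l, g l else 0, C, fun r hr => ?_⟩
  rw [EE_single N j hj, cv_ek]
  have e : ∫ l in Set.Iio r, g l = (∫ l, g l) - ∫ l in Set.Ioi r, g l := by
    rw [setIntegral_congr_set Iio_ae_eq_Iic, ← Set.compl_Iic]
    have := integral_add_compl (measurableSet_Iic (a := r)) hgi
    linarith
  rw [e]
  have hb := norm_integral_le_of_norm_le (hex r hr) (hbI r hr)
  rw [integral_const_mul, integral_exp_mul_Ioi (by linarith), Real.norm_eq_abs] at hb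
  have hb2 : |∫ l in Set.Ioi r, g l| ≤ C * Real.exp (((j : ℝ) - N) * r) := by
    refine hb.trans (mul_le_mul_of_nonneg_left ?_ c0)
    rw [neg_div, ← div_neg]
    exact div_le_self (Real.exp_pos _).le (by linarith)
  have e2 : Real.exp (-((j : ℝ) + 1) * r) * ((∫ l, g l) - ∫ l in Set.Ioi r, g l) -
      ((∫ l, g l) + 0 * r) * Real.exp (-((j : ℝ) + 1) * r) =
      - (Real.exp (-((j : ℝ) + 1) * r) * ∫ l in Set.Ioi r, g l) := by ring
  rw [e2, abs_neg, abs_mul, abs_of_pos (Real.exp_pos _)]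
  refine (mul_le_mul_of_nonneg_left hb2 (Real.exp_pos _).le).trans ?_
  rw [mul_left_comm, ← Real.exp_add]
  refine mul_le_mul_of_nonneg_left (Real.exp_le_exp.2 (by nlinarith)) c0

open MeasureTheory in
lemma Xp_ee {N j k : ℕ} (hj : j < N) (hk : k < N) :
    Xp N (cv (ek j) (ek k)) (fun i => if i = j then (if k = j then 1 else 0) else 0) := by
  have hcvint : ∀ r : ℝ, 0 ≤ r → cv (ek j) (ek k) r =
      Real.exp (-((j : ℝ) + 1) * r) * ∫ l in (0 : ℝ)..r, Real.exp (((j : ℝ) - k) * l) := by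
    intro r hr
    rw [cv_ek, intervalIntegral.integral_of_le hr, setIntegral_congr_set Ioo_ae_eq_Ioc.symm]
    congr 1
    rw [← integral_indicator measurableSet_Iio, ← integral_indicator measurableSet_Ioo]
    congr 1
    funext l
    simp only [ek, Set.indicator, Set.mem_Iio, Set.mem_Ioo, Left.neg_neg_iff]
    by_cases h1 : l < r <;> by_cases h2 : 0 < l <;> simp [h1, h2]
    rw [← Real.exp_add]; congr 1; ring
  by_cases hjk : k = j
  · subst hjk
    refine ⟨fun i => if i = k then 0 else 0, 0, fun r hr => ?_⟩
    rw [if_pos rfl, EE_single N k hk, hcvint r hr]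
    simp [mul_comm]
  · simp only [hjk, if_false]
    have hne : (j : ℝ) - k ≠ 0 := by
      rw [sub_ne_zero]; exact_mod_cast (Ne.symm hjk)
    refine Xp_congr (b := fun i => (if i = k then 0 else 0) + (if i = j then 0 else 0)) ?_ (by simp)
    refine ⟨fun i => (if i = k then 1 / ((j : ℝ) - k) else 0) +
      (if i = j then - (1 / ((j : ℝ) - k)) else 0), 0, fun r hr => ?_⟩
    have hI : ∫ l in (0 : ℝ)..r, Real.exp (((j : ℝ) - k) * l) =
        (Real.exp (((j : ℝ) - k) * r) - 1) / ((j : ℝ) - k) := by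
      rw [intervalIntegral.integral_comp_mul_left (fun x => Real.exp x) hne]
      simp [div_eq_inv_mul]
    rw [EE_add, EE_single N j hj, EE_single N k hk, hcvint r hr, hI]
    have : Real.exp (-((k : ℝ) + 1) * r) =
        Real.exp (-((j : ℝ) + 1) * r) * Real.exp (((j : ℝ) - k) * r) := by
      rw [← Real.exp_add]; congr 1; ring
    rw [this]
    apply le_of_eq
    rw [zero_mul (Real.exp (-((N : ℝ) + 1/2) * r)), abs_eq_zero]
    field_simp
    ring

/-- remainder -/
def Rr (N : ℕ) (F : ℝ → ℝ) (α : ℕ → ℝ) (x : ℝ) : ℝ :=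
  F x - ∑ k ∈ Finset.range N, α (k + 1) * ek k x

lemma Rr_Rm {N : ℕ} {F : ℝ → ℝ} {α : ℕ → ℝ} (hF : Cls F α) (h0 : α 0 = 0) (hm : Measurable F) :
    Rm N (Rr N F α) := by
  obtain ⟨h1, C1, c1, g1⟩ := hF
  obtain ⟨K, k0, f⟩ := h1 (N + 1)
  have hpos : ∀ x, 0 ≤ x → Rr N F α x = F x := by
    intro x hx
    simp [Rr, ek, not_lt.2 hx]
  have hneg : ∀ x, x < 0 → |Rr N F α x| ≤ K * Real.exp (((N : ℝ) + 1) * x) := by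
    intro x hx
    have := f x hx.le
    rw [Finset.sum_range_succ'] at this
    simpa [Rr, ek, hx, h0] using this
  refine ⟨?_, C1 + K, by positivity, fun x hx => ?_, fun x hx => ?_⟩
  · refine hm.sub (Finset.measurable_sum _ (fun k _ => ((ek_Rm k).1.const_mul _)))
  · rw [add_mul]
    have p1 : 0 ≤ C1 * Real.exp (((N : ℝ) + 1) * x) := by positivity
    rcases hx.lt_or_eq with h | h
    · linarith [hneg x h]
    · subst h
      rw [hpos 0 le_rfl]
      have := g1 0 le_rfl
      simp at this ⊢
      linarith
  · rw [hpos x hx, add_mul]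
    have p1 : 0 ≤ K * Real.exp (x / 4) := by positivity
    linarith [g1 x hx]

lemma Cls_Rm {F : ℝ → ℝ} {α : ℕ → ℝ} (hF : Cls F α) (h0 : α 0 = 0) (hm : Measurable F) : Rm 0 F := by
  have := Rr_Rm (N := 0) hF h0 hm
  have e : Rr 0 F α = F := by funext x; simp [Rr]
  rwa [e] at this

open MeasureTheory in
lemma cv_decomp {N : ℕ} {F g : ℝ → ℝ} {α : ℕ → ℝ} (hF : Cls F α) (h0 : α 0 = 0) (hm : Measurable F)
    (hg : Rm 0 g) : cv F g = fun r =>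
      (∑ k ∈ Finset.range N, α (k + 1) * cv (ek k) g r) + cv (Rr N F α) g r := by
  funext r
  unfold cv
  have i1 : ∀ k ∈ Finset.range N, Integrable (fun l => α (k + 1) * (ek k (l - r) * g (-l))) :=
    fun k _ => (cv_int (ek_Rm k) hg r).const_mul _
  have i2 := cv_int (Rm_zero (Rr_Rm (N := N) hF h0 hm)) hg r
  simp only [← integral_const_mul]
  rw [← integral_finsetSum _ i1, ← integral_add (integrable_finsetSum _ i1) i2]
  congr 1
  funext l
  simp only [Rr, sub_mul, Finset.sum_mul, mul_assoc]
  ring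

lemma Xp_step {N : ℕ} {F g : ℝ → ℝ} {α : ℕ → ℝ} (hF : Cls F α) (h0 : α 0 = 0) (hm : Measurable F)
    (hg : Rm 0 g) (b : ℕ → ℕ → ℝ) (b' : ℕ → ℝ) (h1 : ∀ k < N, Xp N (cv (ek k) g) (b k))
    (h2 : Xp N (cv (Rr N F α) g) b') :
    Xp N (cv F g) (fun i => (∑ k ∈ Finset.range N, α (k + 1) * b k i) + b' i) := by
  rw [cv_decomp (N := N) hF h0 hm hg]
  exact Xp_add (Xp_sum _ _ _ (fun k hk => Xp_smul _ (h1 k (Finset.mem_range.1 hk)))) h2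

lemma cv_comm' (f g : ℝ → ℝ) : cv f g = cv g f := funext (cv_comm f g)

lemma Xp_main {N : ℕ} {F G : ℝ → ℝ} {α β : ℕ → ℝ} (hF : Cls F α) (h0 : α 0 = 0) (hm : Measurable F)
    (hG : Cls G β) (h0' : β 0 = 0) (hm' : Measurable G) :
    Xp N (cv F G) (fun k => α (k + 1) * β (k + 1)) := by
  have hGm := Cls_Rm hG h0' hm'
  have s1 : ∀ j < N, Xp N (cv (ek j) G) (fun i => if i = j then β (j + 1) else 0) := by
    intro j hj
    rw [cv_comm']
    refine Xp_congr (Xp_step (N := N) hG h0' hm' (ek_Rm j) _ _ (fun k hk => Xp_ee hk hj)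
      (by rw [cv_comm']; exact Xp_eR hj (Rr_Rm hG h0' hm'))) ?_
    intro i hi
    rw [Finset.sum_eq_single_of_mem i (Finset.mem_range.2 hi)]
    · by_cases h : i = j
      · simp [h]
      · simp [h, Ne.symm h]
    · intro k _ hk; simp [Ne.symm hk]
  have s2 : Xp N (cv (Rr N F α) G) (fun _ => 0) := by
    rw [cv_comm']
    have hR := Rr_Rm (N := N) hF h0 hm
    refine Xp_congr (Xp_step (N := N) hG h0' hm' (Rm_zero hR) _ _ (fun k hk => Xp_eR hk hR)
      (Xp_RR (Rr_Rm hG h0' hm') hR)) ?_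
    intro i _; simp
  refine Xp_congr (Xp_step hF h0 hm hGm _ _ s1 s2) ?_
  intro i hi
  rw [Finset.sum_eq_single_of_mem i (Finset.mem_range.2 hi)]
  · simp
  · intro k _ hk; simp [Ne.symm hk]

open MeasureTheory in
lemma Cv_cv (a b : List Bool) (ha : good a) (ha0 : a ≠ []) (hb : good b) (hb0 : b ≠ []) (r : ℝ) :
    Cv (FE a) (fun l => FE b (-l)) r =
      ENNReal.ofReal (cv (fun x => (FE a x).toReal) (fun x => (FE b x).toReal) r) := by
  obtain ⟨f1, c1⟩ := FE_Cls a ha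
  obtain ⟨f2, c2⟩ := FE_Cls b hb
  have R1 := Cls_Rm c1 (al_zero a ha0) (FE_meas a).ennreal_toReal
  have R2 := Cls_Rm c2 (al_zero b hb0) (FE_meas b).ennreal_toReal
  unfold cv Cv
  rw [ofReal_integral_eq_lintegral_ofReal (cv_int R1 R2 r)
    (Filter.Eventually.of_forall (fun l => mul_nonneg ENNReal.toReal_nonneg ENNReal.toReal_nonneg))]
  congr 1
  funext l
  rw [ENNReal.ofReal_mul ENNReal.toReal_nonneg, ENNReal.ofReal_toReal (f1 _),
    ENNReal.ofReal_toReal (f2 _)]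

/-! ### Part three g : conclusion -/

/-- expansion in `s` -/
def HasExp (N : ℕ) (Φ : ℕ → ℝ) (b : ℕ → ℝ) : Prop :=
  ∃ (a : ℕ → ℝ) (C : ℝ), ∀ s : ℕ, |Φ s - EE N a b s 0| ≤ C / ((N : ℝ) + 1/2) ^ s

lemma HasExp_add {N : ℕ} {h h' : ℕ → ℝ} {b b' : ℕ → ℝ} (H1 : HasExp N h b) (H2 : HasExp N h' b') :
    HasExp N (fun r => h r + h' r) (fun k => b k + b' k) := by
  obtain ⟨a, C, f⟩ := H1
  obtain ⟨a', C', f'⟩ := H2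
  refine ⟨fun k => a k + a' k, C + C', fun r => ?_⟩
  rw [EE_add, add_div, add_sub_add_comm]
  exact (abs_add_le _ _).trans (add_le_add (f r) (f' r))

lemma HasExp_smul {N : ℕ} {h : ℕ → ℝ} {b : ℕ → ℝ} (c : ℝ) (H1 : HasExp N h b) :
    HasExp N (fun r => c * h r) (fun k => c * b k) := by
  obtain ⟨a, C, f⟩ := H1
  refine ⟨fun k => c * a k, |c| * C, fun r => ?_⟩
  rw [EE_smul, ← mul_sub, abs_mul, mul_div_assoc]
  exact mul_le_mul_of_nonneg_left (f r) (abs_nonneg _)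

lemma HasExp_sum {N : ℕ} {ι : Type} (S : Finset ι) (h : ι → ℕ → ℝ) (b : ι → ℕ → ℝ)
    (H1 : ∀ i ∈ S, HasExp N (h i) (b i)) :
    HasExp N (fun r => ∑ i ∈ S, h i r) (fun k => ∑ i ∈ S, b i k) := by
  classical
  induction S using Finset.induction_on with
  | empty => exact ⟨fun _ => 0, 0, fun s => by simp [EE]⟩
  | insert i S hi ih =>
    simp only [Finset.sum_insert hi]
    exact HasExp_add (H1 i (by simp)) (ih (fun j hj => H1 j (by simp [hj])))

lemma HasExp_unique {N : ℕ} {b : ℕ → ℝ} (H1 : HasExp N (fun _ => 0) b) : ∀ k < N, b k = 0 := by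
  obtain ⟨a, C, f⟩ := H1
  suffices ∀ k, k < N → a k = 0 ∧ b k = 0 from fun k hk => (this k hk).2
  intro k
  induction k using Nat.strong_induction_on with
  | _ k ih =>
  intro hk
  have hkN : (k : ℝ) + 1 ≤ N := by exact_mod_cast hk
  let u : ℕ → ℕ → ℝ := fun j s =>
    (a j + b j * s / (j + 1)) * (((k : ℝ) + 1) / ((j : ℝ) + 1)) ^ s
  have hsum : ∀ s : ℕ, ((k : ℝ) + 1) ^ s * EE N a b s 0 = ∑ j ∈ Finset.range N, u j s := by
    intro s
    unfold EE
    rw [Finset.mul_sum]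
    refine Finset.sum_congr rfl (fun j _ => ?_)
    simp only [u, div_pow, mul_zero, add_zero, Real.exp_zero, mul_one]
    ring
  have t1 : Filter.Tendsto (fun s : ℕ => ((k : ℝ) + 1) ^ s * EE N a b s 0) Filter.atTop (nhds 0) := by
    have hq : Filter.Tendsto (fun s : ℕ => C * (((k : ℝ) + 1) / ((N : ℝ) + 1/2)) ^ s)
        Filter.atTop (nhds 0) := by
      have := (tendsto_pow_atTop_nhds_zero_of_lt_one (r := ((k : ℝ) + 1) / ((N : ℝ) + 1/2))
        (by positivity) (by rw [div_lt_one (by positivity)]; linarith)).const_mul C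
      simpa using this
    refine squeeze_zero_norm (fun s => ?_) hq
    have := f s
    rw [zero_sub, abs_neg] at this
    rw [Real.norm_eq_abs, abs_mul, abs_of_pos (by positivity : (0 : ℝ) < ((k : ℝ) + 1) ^ s), div_pow]
    refine (mul_le_mul_of_nonneg_left this (by positivity)).trans (le_of_eq ?_)
    ring
  have t2 : ∀ j ∈ (Finset.range N).erase k, Filter.Tendsto (u j) Filter.atTop (nhds 0) := by
    intro j hj
    rw [Finset.mem_erase, Finset.mem_range] at hj
    rcases lt_or_gt_of_ne hj.1 with h | h
    · obtain ⟨h1, h2⟩ := ih j h hj.2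
      have : u j = fun _ => 0 := by funext s; simp [u, h1, h2]
      rw [this]; exact tendsto_const_nhds
    · have hkj : (k : ℝ) < j := by exact_mod_cast h
      have q0 : 0 ≤ ((k : ℝ) + 1) / ((j : ℝ) + 1) := by positivity
      have q1 : ((k : ℝ) + 1) / ((j : ℝ) + 1) < 1 := by
        rw [div_lt_one (by positivity)]; linarith
      have l1 := (tendsto_pow_atTop_nhds_zero_of_lt_one q0 q1).const_mul (a j)
      have l2 := (tendsto_self_mul_const_pow_of_lt_one q0 q1).const_mul (b j / (j + 1))
      have := l1.add l2
      simp only [mul_zero, add_zero] at this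
      refine this.congr (fun s => ?_)
      simp only [u]; ring
  have t3 : Filter.Tendsto (fun s : ℕ => a k + b k * s / (k + 1)) Filter.atTop (nhds 0) := by
    have := t1.sub (tendsto_finsetSum _ t2)
    simp only [Finset.sum_const_zero, sub_zero] at this
    refine this.congr (fun s => ?_)
    rw [hsum, ← Finset.add_sum_erase _ _ (Finset.mem_range.2 hk)]
    have hk0 : (k : ℝ) + 1 ≠ 0 := by positivity
    simp [u, div_self hk0]
  have t4 := (t3.comp (Filter.tendsto_add_atTop_nat 1)).sub t3
  have hb : b k = 0 := by
    have hc : Filter.Tendsto (fun _ : ℕ => b k / (k + 1)) Filter.atTop (nhds 0) := by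
      rw [sub_zero] at t4
      refine t4.congr (fun s => ?_)
      simp only [Function.comp]
      push_cast
      ring
    have := tendsto_nhds_unique tendsto_const_nhds hc
    have hk0 : (k : ℝ) + 1 ≠ 0 := by positivity
    exact (div_eq_zero_iff.1 this).resolve_right hk0
  refine ⟨?_, hb⟩
  simp only [hb, zero_mul, zero_div, add_zero] at t3
  exact tendsto_nhds_unique tendsto_const_nhds t3

open MeasureTheory in
lemma HasExp_word (Z : H →ₗ[ℚ] ℝ) (hZ : IsZetaMap Z) (N : ℕ) (a L : List Bool) (ha : good a)
    (ha0 : a ≠ []) :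
    HasExp N (fun s => Z (wd a.reverse * (Hx + Hy) ^ (s + 1) * wd (L ++ [false])))
      (fun k => (hh (phi (wd a.reverse)) (k + 1) : ℝ) *
        (hh (phi (tau (wd (L ++ [false]))).unop) (k + 1) : ℝ)) := by
  set B := L ++ [false] with hB
  set b : List Bool := B.map (! ·) with hb
  have hbg : good b := by
    rw [hb, hB, List.map_append]; exact good_append _
  have hb0 : b ≠ [] := by rw [hb, hB]; simp
  have hGE : GE B = fun l => FE b (-l) := rfl
  have hfin : ∀ a, good a → a ≠ [] → ∀ r, Cv (FE a) (GE B) r ≠ ⊤ := by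
    intro a ha ha0 r
    rw [hGE, Cv_cv a b ha ha0 hbg hb0]; exact ENNReal.ofReal_ne_top
  have hZJ := fun s => Z_J Z hZ B (by rw [hB]; simp) (fun a ha ha0 => by
    have := hfin a ha ha0 0
    simpa only [Cv, sub_zero] using this) s a ha ha0
  obtain ⟨f1, c1⟩ := FE_Cls a ha
  obtain ⟨f2, c2⟩ := FE_Cls b hbg
  obtain ⟨A, C, hA⟩ := Xp_main (N := N) c1 (al_zero a ha0) (FE_meas a).ennreal_toReal
    c2 (al_zero b hb0) (FE_meas b).ennreal_toReal
  have hco : (fun k => al a (k + 1) * al b (k + 1)) =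
      (fun k => (hh (phi (wd a.reverse)) (k + 1) : ℝ) *
        (hh (phi (tau (wd B)).unop) (k + 1) : ℝ)) := by
    funext k
    have e : wd b.reverse = (tau (wd B)).unop := by rw [tau_wd, hb, List.map_reverse]
    simp only [al]
    rw [e]
    have : ((-1 : ℝ) ^ (k + 1)) * (-1) ^ (k + 1) = 1 := by rw [← mul_pow]; simp
    rw [mul_mul_mul_comm, this, one_mul]
  rw [hco] at hA
  refine ⟨A, C, fun s => ?_⟩
  have hcvnn : ∀ r, 0 ≤ cv (fun x => (FE a x).toReal) (fun x => (FE b x).toReal) r :=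
    fun r => integral_nonneg (fun l => mul_nonneg ENNReal.toReal_nonneg ENNReal.toReal_nonneg)
  have key := iter_exp (fun s => Cv (JE^[s] (FE a)) (GE B))
    (fun s => Cv_meas _ _ (JE_iter_meas s _ (FE_meas a)) (GE_meas B))
    (fun s r => by
      simp only [Function.iterate_succ_apply']
      exact Cv_JE _ _ (JE_iter_meas s _ (FE_meas a)) (GE_meas B) r)
    N A _ C (fun r _ => hfin a ha ha0 r) (fun r hr => by
      have := hA r hr
      simp only [Function.iterate_zero, id_eq]
      rw [hGE, Cv_cv a b ha ha0 hbg hb0, ENNReal.toReal_ofReal (hcvnn r)]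
      exact this) s 0 le_rfl
  have k2 := key.2
  rw [mul_zero, Real.exp_zero, mul_one] at k2
  simp only [Cv, sub_zero] at k2
  simp only [(hZJ s).2]
  exact k2

lemma HasExp_all (Z : H →ₗ[ℚ] ℝ) (hZ : IsZetaMap Z) (N : ℕ) (w v : H) :
    HasExp N (fun s => Z (Hy * w * (Hx + Hy) ^ (s + 1) * (v * Hx)))
      (fun k => (hh (phi (Hy * w)) (k + 1) : ℝ) * (hh (phi (tau (v * Hx)).unop) (k + 1) : ℝ)) := by
  induction w using H_ind with
  | h1 L =>
    induction v using H_ind with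
    | h1 L' =>
      have := HasExp_word Z hZ N (L.reverse ++ [true]) L' (good_append _) (by simp)
      have e : wd (L.reverse ++ [true]).reverse = Hy * wd L := by
        rw [List.reverse_append, wd_append]; simp [wd_true]
      have e' : wd (L' ++ [false]) = wd L' * Hx := by rw [wd_append, wd_false]
      rwa [e, e'] at this
    | h2 a b ha hb =>
      have := HasExp_add ha hb
      simp only [← mul_add, ← map_add] at this
      simpa [add_mul, mul_add] using this
    | h3 c a ha =>
      have := HasExp_smul (c : ℝ) ha
      simpa [mul_left_comm, Rat.smul_def] using this
  | h2 a b ha hb =>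
    have := HasExp_add ha hb
    simpa [add_mul, mul_add] using this
  | h3 c a ha =>
    have := HasExp_smul (c : ℝ) ha
    simpa [mul_assoc, Rat.smul_def] using this

lemma analysis (Z : H →ₗ[ℚ] ℝ) (hZ : IsZetaMap Z) (M : ℕ) (c : Fin M → ℚ) (A B : Fin M → H)
    (hA : ∀ i, ∃ w, A i = Hy * w) (hB : ∀ i, ∃ w, B i = w * Hx)
    (h : ∀ s : ℕ, ∑ i, (c i : ℝ) * Z (A i * (Hx + Hy) ^ s * B i) = 0) (k : ℕ) :
    ∑ i, c i * (hh (phi (A i)) k * hh (phi (tau (B i)).unop) k) = 0 := by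
  cases k with
  | zero =>
    refine Finset.sum_eq_zero (fun i _ => ?_)
    obtain ⟨w, hw⟩ := hA i
    have : hh (phi (A i)) 0 = 0 := by
      rw [hw, map_mul, phi_y, neg_mul, map_neg, Pi.neg_apply, hh_zero_y, neg_zero]
    rw [this]; ring
  | succ k =>
    have h1 := HasExp_sum (N := k + 1) Finset.univ
      (fun i s => (c i : ℝ) * Z (A i * (Hx + Hy) ^ (s + 1) * B i))
      (fun i k => (c i : ℝ) * ((hh (phi (A i)) (k + 1) : ℝ) *
        (hh (phi (tau (B i)).unop) (k + 1) : ℝ)))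
      (fun i _ => by
        obtain ⟨w, hw⟩ := hA i
        obtain ⟨v, hv⟩ := hB i
        rw [hw, hv]
        exact HasExp_smul _ (HasExp_all Z hZ (k + 1) w v))
    simp only [h] at h1
    have := HasExp_unique h1 k (by omega)
    exact_mod_cast this

/-- If `∑_{i=1}^M n_i f(A_i, B_i) = 0` in `ℝ^ℕ` with `A_i ∈ yℌ`
and `B_i ∈ ℌx`, then `∑_{i=1}^M n_i A_i B_i` lies in the `ℚ`-linear span of
`{φ(u ∗ v)x : u, v ∈ yℌ}` (the linear part of Kawashima's relation). -/
theorem statement4 (Z : H →ₗ[ℚ] ℝ) (hZ : IsZetaMap Z)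
    (st : H →ₗ[ℚ] H →ₗ[ℚ] H) (hst : IsHarmonic st)
    (M : ℕ) (c : Fin M → ℚ) (A B : Fin M → H)
    (hA : ∀ i, ∃ w, A i = Hy * w) (hB : ∀ i, ∃ w, B i = w * Hx)
    (h : ∀ s : ℕ, ∑ i, (c i : ℝ) * Z (A i * (Hx + Hy) ^ s * B i) = 0) :
    (∑ i, c i • (A i * B i)) ∈
      Submodule.span ℚ {w : H | ∃ p q : H, w = phi (st (Hy * p) (Hy * q)) * Hx} := by
  exact final_alg st hst M c A B hA hB (analysis Z hZ M c A B hA hB h)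

end
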